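/- arXiv:1907.12497 — 3 statements merged into one kernel-verified Lean document; each statement's English description precedes it below -/
import Mathlib

section
/- Let A be a supersolvable line arrangement in the complex projective plane ℙ², and let p be a modular point of A whose multiplicity m = m_p(A) ≥ 2 is maximal among the multiplicities of the modular points of A. Then d := |A| ≤ 3m − 3. -/
open scoped LinearAlgebra.Projectivization

noncomputable section

attribute [local instance] Classical.propDecidable

/-- A point of the complex projective plane. -/
abbrev ProjPoint := ℙ ℂ (Fin 3 → ℂ)

/-- A line of the complex projective plane, encoded by a defining linear form
up to scalar, i.e. as a point of the dual projective plane. -/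
abbrev ProjLine := ℙ ℂ (Module.Dual ℂ (Fin 3 → ℂ))

/-- The incidence relation between points and lines of `ℙ²`. -/
def PointOnLine (p : ProjPoint) (L : ProjLine) : Prop :=
  L.rep p.rep = 0

/-- The multiplicity of a point with respect to a line arrangement:
the number of lines of the arrangement passing through the point. -/
def mult (A : Finset ProjLine) (p : ProjPoint) : ℕ :=
  Set.ncard {L : ProjLine | L ∈ A ∧ PointOnLine p L}

/-- An intersection point of a line arrangement: a point lying on at least two lines. -/
def IsIntersectionPoint (A : Finset ProjLine) (p : ProjPoint) : Prop :=
  2 ≤ mult A p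

/-- A modular point: an intersection point `p` such that for any other intersection
point `q`, the line through `p` and `q` belongs to the arrangement. -/
def IsModular (A : Finset ProjLine) (p : ProjPoint) : Prop :=
  IsIntersectionPoint A p ∧
    ∀ q : ProjPoint, IsIntersectionPoint A q → q ≠ p →
      ∃ L ∈ A, PointOnLine p L ∧ PointOnLine q L

/-- A supersolvable line arrangement: one possessing a modular point. -/
def IsSupersolvable (A : Finset ProjLine) : Prop :=
  ∃ p, IsModular A p

/-- An `m`-homogeneous supersolvable line arrangement: supersolvable, and all
modular points have multiplicity `m`. -/
def IsHomogSS (A : Finset ProjLine) (m : ℕ) : Prop :=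
  IsSupersolvable A ∧ ∀ p, IsModular A p → mult A p = m

/-- `nk A k` is the number of intersection points of multiplicity `k` of `A`. -/
def nk (A : Finset ProjLine) (k : ℕ) : ℕ :=
  Set.ncard {p : ProjPoint | IsIntersectionPoint A p ∧ mult A p = k}

/-- A pencil: all lines pass through a common point. -/
def IsPencil (A : Finset ProjLine) : Prop :=
  ∃ p, ∀ L ∈ A, PointOnLine p L

section Core
open Polynomial

def linPoly (s : ℂ × ℂ) : ℂ[X] := C s.1 * X + C s.2

lemma linPoly_inj {s t : ℂ × ℂ} (h : linPoly s = linPoly t) : s = t := by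
  have h0 := congrArg (fun q => coeff q 0) h
  have h1 := congrArg (fun q => coeff q 1) h
  simp [linPoly] at h0 h1
  exact Prod.ext h1 h0

lemma prod_dvd_eval {R : Type*} [CommRing R] [IsDomain R] {ι : Type*} (I : Finset ι) (r : ι → R)
    (hr : Set.InjOn r I) (q : R[X]) (hq : ∀ i ∈ I, q.eval (r i) = 0) (t : R) :
    ∏ i ∈ I, (t - r i) ∣ q.eval t := by
  have h : ∏ i ∈ I, (X - C (r i)) ∣ q := by
    by_cases hq0 : q = 0
    · simp [hq0]
    have : (Multiset.map (fun a => X - C a) (I.val.map r)).prod ∣ q := by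
      rw [Multiset.prod_X_sub_C_dvd_iff_le_roots hq0]
      rw [Multiset.le_iff_subset]
      · intro x hx
        simp at hx
        obtain ⟨i, hi, rfl⟩ := hx
        exact (mem_roots hq0).2 (hq i hi)
      · exact (Multiset.nodup_map_iff_of_inj_on (fun x hx y hy h => hr hx hy h)).2 I.nodup
    simpa [Multiset.map_map] using this
  have := map_dvd (evalRingHom t) h
  simpa [map_prod] using this

lemma lin_sub {s t : ℂ × ℂ} {a : ℂ} (h : s.1 * a + s.2 = t.1 * a + t.2) :
    linPoly s - linPoly t = C (s.1 - t.1) * (X - C a) := by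
  have : s.2 - t.2 = - ((s.1 - t.1) * a) := by linear_combination h
  have h2 : C s.2 - C t.2 = - ((C s.1 - C t.1) * C a) := by
    rw [← C_sub, this]; simp
  simp only [linPoly, C_sub]
  linear_combination h2

lemma lin_fst_ne {s t : ℂ × ℂ} {a : ℂ} (hst : s ≠ t) (h : s.1 * a + s.2 = t.1 * a + t.2) :
    s.1 - t.1 ≠ 0 := by
  intro h0
  have h1 : s.1 = t.1 := sub_eq_zero.1 h0
  apply hst
  refine Prod.ext h1 ?_
  rw [h1] at h
  exact add_left_cancel h

lemma interp (T : Finset ℂ) (hm : 2 ≤ T.card) (S : Finset (ℂ × ℂ))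
    (h : ∀ s ∈ S, ∀ t ∈ S, s ≠ t → ∃ a ∈ T, s.1 * a + s.2 = t.1 * a + t.2) :
    ∃ g : ℂ[X][X], g.natDegree ≤ T.card - 1 ∧
      (∀ s, (g.eval (linPoly s)).natDegree ≤ T.card - 1) ∧
      ∀ s ∈ S, X ^ (T.card - 1) * linPoly s + g.eval (linPoly s)
        = (∏ a ∈ T, (X - C a)) * C s.1 := by
  classical
  induction S using Finset.induction_on with
  | empty => exact ⟨0, by simp, by simp, by simp⟩
  | insert s S hs ih =>
    obtain ⟨g, hg1, hg2, hg3⟩ := ih (fun s hs t ht => h s (by simp [hs]) t (by simp [ht]))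
    set n := T.card - 1 with hn
    set P : ℂ[X] := ∏ a ∈ T, (X - C a) with hP
    set ν := P * C s.1 - X ^ n * linPoly s - g.eval (linPoly s) with hν
    have hPm : P.Monic := monic_prod_of_monic _ _ (fun a _ => monic_X_sub_C a)
    have hPd : P.natDegree = n + 1 := by
      rw [hP, natDegree_prod_of_monic _ _ (fun a _ => monic_X_sub_C a)]
      simp; omega
    have hνd : ν.natDegree ≤ n := by
      have e : ν = (P - X ^ (n+1)) * C s.1 - C s.2 * X ^ n - g.eval (linPoly s) := by
        rw [hν, linPoly]; ring
      have h1 : (P - X ^ (n+1)).natDegree ≤ n := by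
        rw [natDegree_le_iff_coeff_eq_zero]
        intro N hN
        rw [coeff_sub, coeff_X_pow]
        split_ifs with hc
        · rw [hc, ← hPd, hPm.coeff_natDegree]; simp
        · rw [coeff_eq_zero_of_natDegree_lt (by omega)]; simp
      rw [e]
      refine (natDegree_sub_le_of_le (natDegree_sub_le_of_le ((natDegree_mul_C_le _ _).trans h1) ((natDegree_C_mul_le _ _).trans (natDegree_X_pow_le n))) (hg2 s)).trans ?_
      simp
    have hst : ∀ t ∈ S, ∃ a ∈ T, s.1 * a + s.2 = t.1 * a + t.2 := fun t ht =>
      h s (by simp) t (by simp [ht]) (fun e => hs (e ▸ ht))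
    choose! b hb1 hb2 using hst
    have hne : ∀ t ∈ S, s.1 - t.1 ≠ 0 := fun t ht =>
      lin_fst_ne (fun e => hs (e ▸ ht)) (hb2 t ht)
    have hdeg1 : ∀ t ∈ S, (linPoly s - linPoly t).natDegree = 1 := by
      intro t ht
      rw [lin_sub (hb2 t ht), natDegree_C_mul (hne t ht), natDegree_X_sub_C]
    have hD : ∏ t ∈ S, (linPoly s - linPoly t) ∣ ν := by
      rw [← Finset.prod_fiberwise_of_maps_to hb1]
      apply Finset.prod_dvd_of_coprime
      · intro a ha a' ha' haa
        apply IsCoprime.prod_left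
        intro t ht
        apply IsCoprime.prod_right
        intro t' ht'
        simp only [Finset.mem_filter] at ht ht'
        rw [lin_sub (hb2 t ht.1), lin_sub (hb2 t' ht'.1), ht.2, ht'.2]
        rw [isCoprime_mul_unit_left_left (isUnit_C.2 (hne t ht.1).isUnit),
          isCoprime_mul_unit_left_right (isUnit_C.2 (hne t' ht'.1).isUnit)]
        exact isCoprime_X_sub_C_of_isUnit_sub (sub_ne_zero.2 haa).isUnit
      · intro a ha
        obtain ⟨P', hP'⟩ : (X - C a) ∣ P := Finset.dvd_prod_of_mem _ ha
        set α := s.1 * a + s.2 with hα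
        have key : ∀ t : ℂ × ℂ, t.1 * a + t.2 = α →
            (C (X ^ n) * X + g - C P' * (X - C (C α)) : ℂ[X][X]).eval (linPoly t)
              = X ^ n * linPoly t + g.eval (linPoly t) - P * C t.1 := by
          intro t ht
          have : linPoly t - C α = C t.1 * (X - C a) := by
            rw [← ht, linPoly]; simp; ring
          simp only [eval_sub, eval_add, eval_mul, eval_C, eval_X]
          rw [this, hP']; ring
        have := prod_dvd_eval (S.filter (fun t => b t = a)) linPoly
          (fun x _ y _ hxy => linPoly_inj hxy)
          (C (X ^ n) * X + g - C P' * (X - C (C α)) : ℂ[X][X]) (by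
            intro t ht
            simp only [Finset.mem_filter] at ht
            have e := hb2 t ht.1
            rw [ht.2] at e
            rw [key t e.symm, hg3 t ht.1, sub_self]) (linPoly s)
        rw [key s rfl] at this
        have e : ν = -(X ^ n * linPoly s + g.eval (linPoly s) - P * C s.1) := by
          rw [hν]; ring
        rw [e]
        exact (dvd_neg).2 this
    obtain ⟨c, hc⟩ := hD
    have hcd : c = 0 ∨ c.natDegree + S.card ≤ n := by
      by_cases hc0 : c = 0
      · exact Or.inl hc0
      right
      have hp0 : ∀ t ∈ S, linPoly s - linPoly t ≠ 0 := by
        intro t ht h0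
        have := hdeg1 t ht
        rw [h0] at this; simp at this
      have : ν.natDegree = S.card + c.natDegree := by
        rw [hc, natDegree_mul (Finset.prod_ne_zero_iff.2 hp0) hc0, natDegree_prod _ _ hp0,
          Finset.sum_congr rfl hdeg1]
        simp
      omega
    have hev : ∀ r : ℂ × ℂ, (g + C c * ∏ t ∈ S, (X - C (linPoly t))).eval (linPoly r)
        = g.eval (linPoly r) + c * ∏ t ∈ S, (linPoly r - linPoly t) := by
      intro r
      simp [eval_prod]
    refine ⟨g + C c * ∏ t ∈ S, (X - C (linPoly t)), ?_, ?_, ?_⟩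
    · rcases hcd with h0 | h0
      · simpa [h0] using hg1
      · refine natDegree_add_le_of_degree_le hg1 ((natDegree_C_mul_le _ _).trans ?_)
        rw [natDegree_prod_of_monic _ _ (fun t _ => monic_X_sub_C _)]
        simp; omega
    · intro r
      rw [hev]
      rcases hcd with h0 | h0
      · simpa [h0] using hg2 r
      · refine natDegree_add_le_of_degree_le (hg2 r) (natDegree_mul_le.trans ?_)
        have : (∏ t ∈ S, (linPoly r - linPoly t)).natDegree ≤ S.card := by
          refine (natDegree_prod_le _ _).trans ?_
          rw [Finset.card_eq_sum_ones]
          refine Finset.sum_le_sum fun t _ => ?_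
          have hl : ∀ t, (linPoly t).natDegree ≤ 1 := fun t => natDegree_linear_le
          exact (natDegree_sub_le_of_le (hl r) (hl t)).trans (by simp)
        omega
    · intro r hr
      rw [hev]
      rcases Finset.mem_insert.1 hr with rfl | hr
      · rw [mul_comm c, ← hc, hν]; ring
      · rw [Finset.prod_eq_zero hr (sub_self (linPoly r)), mul_zero, add_zero, hg3 r hr]

/-- The chain rule for `x ↦ g (x, f x)`. -/
lemma deriv_eval (g : ℂ[X][X]) : ∃ G : ℂ[X][X], G.natDegree ≤ g.natDegree ∧
    ∀ f : ℂ[X], derivative (g.eval f) = G.eval f + (derivative g).eval f * derivative f := by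
  refine ⟨∑ i ∈ Finset.range (g.natDegree + 1), monomial i (derivative (g.coeff i)), ?_, ?_⟩
  · refine natDegree_sum_le_of_forall_le _ _ fun i hi => ?_
    refine (natDegree_monomial_le _).trans ?_
    simp at hi; omega
  · intro f
    have h1 : (derivative g).eval f
        = ∑ i ∈ Finset.range (g.natDegree + 1), g.coeff i * i * f ^ (i - 1) := by
      rw [derivative_eval, sum_over_range]
      simp
    rw [h1, eval_eq_sum_range, derivative_sum, eval_finsetSum, Finset.sum_mul,
      ← Finset.sum_add_distrib]
    refine Finset.sum_congr rfl fun i _ => ?_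
    rw [derivative_mul, derivative_pow, eval_monomial]
    simp
    ring

theorem core_concurrent (T : Finset ℂ) (hm : 2 ≤ T.card) (S : Finset (ℂ × ℂ))
    (h : ∀ s ∈ S, ∀ t ∈ S, s ≠ t → ∃ a ∈ T, s.1 * a + s.2 = t.1 * a + t.2)
    (hk : 2 * T.card - 2 ≤ S.card) :
    ∃ a ∈ T, ∃ b, ∀ s ∈ S, s.1 * a + s.2 = b := by
  obtain ⟨g', hg1, -, hg3⟩ := interp T hm S h
  set n := T.card - 1 with hn
  set P : ℂ[X] := ∏ a ∈ T, (X - C a) with hP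
  set g : ℂ[X][X] := C (X ^ n) * X + g' with hg
  have hP0 : P ≠ 0 := (monic_prod_of_monic _ _ (fun a _ => monic_X_sub_C a)).ne_zero
  have hgd : g.natDegree ≤ n :=
    natDegree_add_le_of_degree_le ((natDegree_C_mul_le _ _).trans (by simp; omega)) hg1
  have hge : ∀ s ∈ S, g.eval (linPoly s) = P * C s.1 := by
    intro s hs
    rw [← hg3 s hs, hg]; simp
  have hinj : Set.InjOn linPoly (S : Set (ℂ × ℂ)) := fun x _ y _ hxy => linPoly_inj hxy
  have hr : g.natDegree ≤ 1 := by
    by_contra hr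
    push Not at hr
    set r := g.natDegree with hrr
    obtain ⟨G, hmapd, hG⟩ := deriv_eval g
    rw [← hrr] at hmapd
    set H : ℂ[X][X] := C P * G - C (derivative P) * g + g * derivative g with hH
    have hHd : H.natDegree ≤ 2 * r - 1 := by
      have h1 : (C P * G : ℂ[X][X]).natDegree ≤ 2 * r - 1 :=
        (natDegree_C_mul_le _ _).trans (by omega)
      have h2 : (C (derivative P) * g : ℂ[X][X]).natDegree ≤ 2 * r - 1 :=
        (natDegree_C_mul_le _ _).trans (by omega)
      have h3 : (g * derivative g).natDegree ≤ 2 * r - 1 := by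
        refine natDegree_mul_le.trans ?_
        have := natDegree_derivative_le g
        omega
      exact natDegree_add_le_of_degree_le ((natDegree_sub_le_of_le h1 h2).trans (by simp)) h3
    have hHz : ∀ s ∈ S, H.eval (linPoly s) = 0 := by
      intro s hs
      have e1 := hG (linPoly s)
      rw [hge s hs] at e1
      have e2 : derivative (linPoly s) = C s.1 := by simp [linPoly]
      have e3 : derivative (P * C s.1) = derivative P * C s.1 := by simp
      rw [e2, e3] at e1
      simp only [hH, eval_add, eval_sub, eval_mul, eval_C, hge s hs]
      linear_combination (-P) * e1
    have hH0 : H = 0 := by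
      apply eq_zero_of_natDegree_lt_card_of_eval_eq_zero' H (S.image linPoly)
      · intro i hi
        obtain ⟨s, hs, rfl⟩ := Finset.mem_image.1 hi
        exact hHz s hs
      · rw [Finset.card_image_of_injOn hinj]; omega
    have hc : H.coeff (r + (r - 1)) = g.leadingCoeff * (g.leadingCoeff * r) := by
      rw [hH, coeff_add, coeff_sub, coeff_C_mul, coeff_C_mul,
        coeff_eq_zero_of_natDegree_lt (p := g) (by omega),
        coeff_eq_zero_of_natDegree_lt (p := G) (by omega),
        coeff_mul_add_eq_of_natDegree_le le_rfl (natDegree_derivative_le g), coeff_derivative]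
      have : r - 1 + 1 = r := by omega
      rw [← hrr, this]
      have h2 : ((r - 1 : ℕ) : ℂ[X]) + 1 = r := by exact_mod_cast this
      rw [h2]
      simp [leadingCoeff, ← hrr]
    rw [hH0, coeff_zero] at hc
    have hl : g.leadingCoeff ≠ 0 := by
      rw [leadingCoeff_ne_zero]
      intro h0
      rw [h0] at hrr; simp at hrr; omega
    have hrc : (r : ℂ[X]) ≠ 0 := by
      exact_mod_cast (by omega : r ≠ 0)
    exact mul_ne_zero hl (mul_ne_zero hl hrc) hc.symm
  -- now `g` is linear
  have hpair : ∀ s ∈ S, ∀ t ∈ S, P * C (s.1 - t.1) = g.coeff 1 * (linPoly s - linPoly t) := by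
    intro s hs t ht
    have e1 := hge s hs
    have e2 := hge t ht
    rw [eq_X_add_C_of_natDegree_le_one hr] at e1 e2
    simp at e1 e2
    rw [C_sub]
    linear_combination e2 - e1
  obtain ⟨s0, hs0, s1, hs1, hne⟩ := Finset.one_lt_card.1 (by omega : 1 < S.card)
  obtain ⟨a, ha, hab⟩ := h s0 hs0 s1 hs1 hne
  have hfac : ∀ t ∈ S, s0 ≠ t → ∀ a, s0.1 * a + s0.2 = t.1 * a + t.2 →
      P = g.coeff 1 * (X - C a) := by
    intro t ht hst a hat
    have e := hpair s0 hs0 t ht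
    rw [lin_sub hat] at e
    have hcne : C (s0.1 - t.1) ≠ 0 := C_ne_zero.2 (lin_fst_ne hst hat)
    apply mul_right_cancel₀ hcne
    rw [e]; ring
  have hP1 := hfac s1 hs1 hne a hab
  have hg0 : g.coeff 1 ≠ 0 := by
    intro h0
    rw [h0, zero_mul] at hP1
    exact hP0 hP1
  refine ⟨a, ha, s0.1 * a + s0.2, fun t ht => ?_⟩
  by_cases hst : s0 = t
  · rw [hst]
  obtain ⟨a', -, hat⟩ := h s0 hs0 t ht hst
  have hP2 := hfac t ht hst a' hat
  rw [hP1] at hP2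
  have := mul_left_cancel₀ hg0 hP2
  have haa : a = a' := C_injective (sub_right_injective this)
  rw [haa, hat]

end Core

section Geometry

lemma line_eq_of_smul {L L' : ProjLine} (c : ℂ) (h : L.rep = c • L'.rep) : L = L' := by
  rw [← L.mk_rep, ← L'.mk_rep, Projectivization.mk_eq_mk_iff']
  exact ⟨c, h.symm⟩

lemma point_eq_of_smul {q q' : ProjPoint} (c : ℂ) (h : q.rep = c • q'.rep) : q = q' := by
  rw [← q.mk_rep, ← q'.mk_rep, Projectivization.mk_eq_mk_iff']
  exact ⟨c, h.symm⟩

lemma pointOnLine_mk {w : Fin 3 → ℂ} (hw : w ≠ 0) (L : ProjLine) :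
    PointOnLine (Projectivization.mk ℂ w hw) L ↔ L.rep w = 0 := by
  obtain ⟨a, ha⟩ := Projectivization.exists_smul_eq_mk_rep ℂ w hw
  unfold PointOnLine
  rw [← ha, Units.smul_def, map_smul, smul_eq_mul]
  simp

lemma mult_eq_card (A : Finset ProjLine) (q : ProjPoint) :
    mult A q = (A.filter (fun L => PointOnLine q L)).card := by
  unfold mult
  rw [← Set.ncard_coe_finset]
  congr 1
  ext L
  simp

lemma exists_common (f g : Module.Dual ℂ (Fin 3 → ℂ)) :
    ∃ w : Fin 3 → ℂ, w ≠ 0 ∧ f w = 0 ∧ g w = 0 := by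
  have h : LinearMap.ker (LinearMap.prod f g) ≠ ⊥ :=
    LinearMap.ker_ne_bot_of_finrank_lt (by simp)
  obtain ⟨w, hw, hw0⟩ := Submodule.exists_mem_ne_zero_of_ne_bot h
  have : f w = 0 ∧ g w = 0 := by simpa using hw
  exact ⟨w, hw0, this.1, this.2⟩

lemma exists_frame (A : Finset ProjLine) (p : ProjPoint) (M : ProjLine) (hM : M ∈ A)
    (hMp : PointOnLine p M) :
    ∃ e0 e1 : Fin 3 → ℂ, (∀ L ∈ A, PointOnLine p L → L.rep e1 ≠ 0) ∧
      (∀ w : Fin 3 → ℂ, ∃ z x y : ℂ, w = z • e0 + x • e1 + y • p.rep) ∧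
      (∀ x y : ℂ, e0 + x • e1 + y • p.rep ≠ 0) := by
  obtain ⟨e1, he1⟩ := Module.Dual.exists_forall_ne_zero_of_forall_exists
    (fun L : {L // L ∈ A} => (L.1.rep : Module.Dual ℂ (Fin 3 → ℂ))) (by
      intro L
      by_contra hc
      push Not at hc
      exact L.1.rep_nonzero (LinearMap.ext hc))
  have hli : LinearIndependent ℂ ![e1, p.rep] := by
    rw [LinearIndependent.pair_iff]
    intro s t hst
    have h1 := congrArg M.rep hst
    have hMp' : M.rep p.rep = 0 := hMp
    rw [map_add, map_smul, map_smul, hMp', map_zero] at h1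
    have hs : s = 0 := by simpa [he1 ⟨M, hM⟩] using h1
    refine ⟨hs, ?_⟩
    rw [hs] at hst
    simpa [p.rep_nonzero] using hst
  obtain ⟨e0, he0⟩ := exists_linearIndependent_cons_of_lt_finrank hli (by simp)
  refine ⟨e0, e1, fun L hL _ => he1 ⟨L, hL⟩, ?_, ?_⟩
  · intro w
    let B := basisOfLinearIndependentOfCardEqFinrank he0 (by simp)
    refine ⟨B.repr w 0, B.repr w 1, B.repr w 2, ?_⟩
    have := (B.sum_repr w).symm
    rw [Fin.sum_univ_three] at this
    simpa [B] using this
  · intro x y h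
    rw [Fintype.linearIndependent_iff] at he0
    have := he0 ![1, x, y] (by rw [Fin.sum_univ_three]; simpa using h) 0
    simp at this

end Geometry

/-- If `A` is a supersolvable line arrangement in `ℙ²` and `p` is a
modular point of `A` whose multiplicity `m ≥ 2` is maximal among the multiplicities of
the modular points of `A`, then `|A| ≤ 3m - 3`. -/
theorem card_le_of_modular_max_mult (A : Finset ProjLine) (p : ProjPoint) (m : ℕ)
    (hss : IsSupersolvable A)
    (hp : IsModular A p) (hpm : mult A p = m) (hm2 : 2 ≤ m)
    (hmax : ∀ q : ProjPoint, IsModular A q → mult A q ≤ m) :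
    A.card ≤ 3 * m - 3 := by
  obtain ⟨hpi, hpmod⟩ := hp
  have hpm' := hpm
  rw [mult_eq_card] at hpm
  set Ap := A.filter (fun L => PointOnLine p L) with hAp
  set An := A.filter (fun L => ¬ PointOnLine p L) with hAn
  have hcard : Ap.card + An.card = A.card := Finset.card_filter_add_card_filter_not _
  by_contra hlt
  push Not at hlt
  obtain ⟨M0, hM0⟩ : Ap.Nonempty := Finset.card_pos.1 (by omega)
  obtain ⟨e0, e1, he1, hspan, hne0⟩ :=
    exists_frame A p M0 (Finset.mem_filter.1 hM0).1 (Finset.mem_filter.1 hM0).2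
  have hAp1 : ∀ L ∈ Ap, L.rep e1 ≠ 0 := fun L hL =>
    he1 L (Finset.mem_filter.1 hL).1 (Finset.mem_filter.1 hL).2
  have hAp2 : ∀ L ∈ Ap, L.rep p.rep = 0 := fun L hL => (Finset.mem_filter.1 hL).2
  have hAn2 : ∀ L ∈ An, L.rep p.rep ≠ 0 := fun L hL => (Finset.mem_filter.1 hL).2
  have hrep : ∀ (L : ProjLine) (z x y : ℂ), L.rep (z • e0 + x • e1 + y • p.rep)
      = z * L.rep e0 + x * L.rep e1 + y * L.rep p.rep := by
    intro L z x y
    simp only [map_add, map_smul, smul_eq_mul]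
  have hlineeq : ∀ (L L' : ProjLine) (c : ℂ), L.rep e0 = c * L'.rep e0 →
      L.rep e1 = c * L'.rep e1 → L.rep p.rep = c * L'.rep p.rep → L = L' := by
    intro L L' c h0 h1 h2
    apply line_eq_of_smul c
    refine LinearMap.ext fun w => ?_
    obtain ⟨z, x, y, rfl⟩ := hspan w
    rw [LinearMap.smul_apply, hrep, hrep, h0, h1, h2, smul_eq_mul]
    ring
  set σ : ProjLine → ℂ × ℂ := fun L =>
    (-(L.rep e1) / L.rep p.rep, -(L.rep e0) / L.rep p.rep) with hσ
  set τ : ProjLine → ℂ := fun L => -(L.rep e0) / L.rep e1 with hτ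
  have hσ0 : ∀ L ∈ An, ∀ z x y : ℂ, L.rep (z • e0 + x • e1 + y • p.rep) = 0 ↔
      y = (σ L).1 * x + (σ L).2 * z := by
    intro L hL z x y
    have := hAn2 L hL
    rw [hrep]
    simp only [hσ]
    field_simp
    constructor <;> intro h <;> linear_combination h
  have hτ0 : ∀ L ∈ Ap, ∀ z x y : ℂ, L.rep (z • e0 + x • e1 + y • p.rep) = 0 ↔ x = τ L * z := by
    intro L hL z x y
    have := hAp1 L hL
    rw [hrep, hAp2 L hL]
    simp only [hτ]
    field_simp
    constructor <;> intro h <;> linear_combination h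
  have hσinj : Set.InjOn σ An := by
    intro L hL L' hL' h
    have a1 := hAn2 L hL
    have a2 := hAn2 L' hL'
    simp only [hσ, Prod.mk.injEq] at h
    obtain ⟨h1, h2⟩ := h
    field_simp at h1 h2
    apply hlineeq L L' (L.rep p.rep / L'.rep p.rep) <;> field_simp <;>
      first | linear_combination h1 | linear_combination -h1 | linear_combination h2 | linear_combination -h2
  have hτinj : Set.InjOn τ Ap := by
    intro L hL L' hL' h
    have a1 := hAp1 L hL
    have a2 := hAp1 L' hL'
    simp only [hτ] at h
    field_simp at h
    apply hlineeq L L' (L.rep e1 / L'.rep e1)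
    · field_simp
      first | linear_combination h | linear_combination -h
    · field_simp
    · rw [hAp2 L hL, hAp2 L' hL', mul_zero]
  have hTc : (Ap.image τ).card = m := by rw [Finset.card_image_of_injOn hτinj, hpm]
  have hSc : (An.image σ).card = An.card := Finset.card_image_of_injOn hσinj
  -- a point on a line through `p`, with vanishing last coordinate, is `p`
  have hzne : ∀ r : ProjPoint, r ≠ p → ∀ N ∈ Ap, ∀ z x y : ℂ,
      r.rep = z • e0 + x • e1 + y • p.rep → PointOnLine r N → z ≠ 0 := by
    intro r hr N hN z x y hw hrN hz
    unfold PointOnLine at hrN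
    rw [hw, hτ0 N hN, hz, mul_zero] at hrN
    apply hr
    apply point_eq_of_smul y
    rw [hw, hz, hrN]
    simp
  obtain ⟨a, ha, b, hab⟩ := core_concurrent (Ap.image τ) (by omega) (An.image σ) (by
    intro s hs t ht hst
    obtain ⟨L, hL, rfl⟩ := Finset.mem_image.1 hs
    obtain ⟨L', hL', rfl⟩ := Finset.mem_image.1 ht
    have hLL : L ≠ L' := fun e => hst (by rw [e])
    obtain ⟨w, hw, hw1, hw2⟩ := exists_common L.rep L'.rep
    set q := Projectivization.mk ℂ w hw with hq
    have hq1 : PointOnLine q L := (pointOnLine_mk hw L).2 hw1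
    have hq2 : PointOnLine q L' := (pointOnLine_mk hw L').2 hw2
    have hqp : q ≠ p := by
      intro e
      rw [e] at hq1
      exact hAn2 L hL hq1
    have hqi : IsIntersectionPoint A q := by
      unfold IsIntersectionPoint
      rw [mult_eq_card]
      refine Finset.one_lt_card.2 ⟨L, ?_, L', ?_, hLL⟩
      · exact Finset.mem_filter.2 ⟨(Finset.mem_filter.1 hL).1, hq1⟩
      · exact Finset.mem_filter.2 ⟨(Finset.mem_filter.1 hL').1, hq2⟩
    obtain ⟨M, hMA, hMp, hMq⟩ := hpmod q hqi hqp
    have hM : M ∈ Ap := Finset.mem_filter.2 ⟨hMA, hMp⟩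
    obtain ⟨z, x, y, hxyz⟩ := hspan q.rep
    have hz := hzne q hqp M hM z x y hxyz hMq
    unfold PointOnLine at hq1 hq2 hMq
    rw [hxyz, hσ0 L hL] at hq1
    rw [hxyz, hσ0 L' hL'] at hq2
    rw [hxyz, hτ0 M hM] at hMq
    refine ⟨τ M, Finset.mem_image_of_mem _ hM, ?_⟩
    apply mul_right_cancel₀ hz
    rw [hMq] at hq1 hq2
    linear_combination hq2 - hq1) (by omega)
  obtain ⟨M, hM, rfl⟩ := Finset.mem_image.1 ha
  set q := Projectivization.mk ℂ _ (hne0 (τ M) b) with hq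
  have hMq : PointOnLine q M := by
    rw [hq, pointOnLine_mk]
    have := (hτ0 M hM 1 (τ M) b).2 (by ring)
    rwa [one_smul] at this
  have hAnq : ∀ L ∈ An, PointOnLine q L := by
    intro L hL
    rw [hq, pointOnLine_mk]
    have := (hσ0 L hL 1 (τ M) b).2 (by
      rw [← hab (σ L) (Finset.mem_image_of_mem _ hL)]; ring)
    rwa [one_smul] at this
  have hMA := (Finset.mem_filter.1 hM).1
  have hMn : M ∉ An := fun h => hAn2 M h (hAp2 M hM)
  have hmq : An.card + 1 ≤ mult A q := by
    rw [mult_eq_card, ← Finset.card_insert_of_notMem hMn]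
    apply Finset.card_le_card
    intro L hL
    rcases Finset.mem_insert.1 hL with rfl | hL
    · exact Finset.mem_filter.2 ⟨hMA, hMq⟩
    · exact Finset.mem_filter.2 ⟨(Finset.mem_filter.1 hL).1, hAnq L hL⟩
  have hqmod : IsModular A q := by
    refine ⟨by unfold IsIntersectionPoint; omega, fun r hr hrq => ?_⟩
    by_cases hrp : r = p
    · exact ⟨M, hMA, hMq, by rw [hrp]; exact hAp2 M hM⟩
    obtain ⟨M', hM'A, hM'p, hM'r⟩ := hpmod r hr hrp
    have hM' : M' ∈ Ap := Finset.mem_filter.2 ⟨hM'A, hM'p⟩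
    unfold IsIntersectionPoint at hr
    rw [mult_eq_card] at hr
    obtain ⟨N, hN, hNM⟩ := Finset.exists_mem_ne (lt_of_lt_of_le one_lt_two hr) M'
    obtain ⟨hNA, hNr⟩ := Finset.mem_filter.1 hN
    by_cases hNp : PointOnLine p N
    · exfalso
      have hN' : N ∈ Ap := Finset.mem_filter.2 ⟨hNA, hNp⟩
      obtain ⟨z, x, y, hxyz⟩ := hspan r.rep
      have hz := hzne r hrp N hN' z x y hxyz hNr
      unfold PointOnLine at hNr hM'r
      rw [hxyz, hτ0 N hN'] at hNr
      rw [hxyz, hτ0 M' hM'] at hM'r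
      exact hNM (hτinj hN' hM' (mul_right_cancel₀ hz (hNr.symm.trans hM'r)))
    · exact ⟨N, hNA, hAnq N (Finset.mem_filter.2 ⟨hNA, hNp⟩), hNr⟩
  have := hmax q hqmod
  omega

end
end

section
/- For every integer m ≥ 3, the full monomial line arrangement A(m−2,1,3), defined by xyz(x^{m−2}−y^{m−2})(y^{m−2}−z^{m−2})(x^{m−2}−z^{m−2}) = 0, consists of exactly 3m−3 lines, the three coordinate points (1:0:0), (0:1:0), (0:0:1) are modular points of multiplicity m, and every modular point of A(m−2,1,3) has multiplicity m; in particular A(m−2,1,3) is an m-homogeneous supersolvable line arrangement with 3m−3 lines. -/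
open scoped LinearAlgebra.Projectivization

noncomputable section

attribute [local instance] Classical.propDecidable

/-- The linear form `a x + b y + c z` on `ℂ³`. -/
def mkForm (a b c : ℂ) : Module.Dual ℂ (Fin 3 → ℂ) :=
  a • LinearMap.proj 0 + b • LinearMap.proj 1 + c • LinearMap.proj 2

lemma mkForm_apply (a b c : ℂ) (v : Fin 3 → ℂ) :
    mkForm a b c v = a * v 0 + b * v 1 + c * v 2 := by
  simp [mkForm, smul_eq_mul]

lemma mkForm_ne_zero {a b c : ℂ} (h : a ≠ 0 ∨ b ≠ 0 ∨ c ≠ 0) :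
    mkForm a b c ≠ 0 := by
  intro h0
  have h1 := congrArg (fun φ => φ (Pi.single 0 1)) h0
  have h2 := congrArg (fun φ => φ (Pi.single 1 1)) h0
  have h3 := congrArg (fun φ => φ (Pi.single 2 1)) h0
  simp only [mkForm_apply] at h1 h2 h3
  simp [Pi.single_apply] at h1 h2 h3
  rcases h with h | h | h <;> simp_all

/-- The projective line with equation `a x + b y + c z = 0`. -/
def mkLine (a b c : ℂ) (h : a ≠ 0 ∨ b ≠ 0 ∨ c ≠ 0) : ProjLine :=
  Projectivization.mk ℂ (mkForm a b c) (mkForm_ne_zero h)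

lemma vec_ne_zero {a b c : ℂ} (h : a ≠ 0 ∨ b ≠ 0 ∨ c ≠ 0) :
    (![a, b, c] : Fin 3 → ℂ) ≠ 0 := by
  intro h0
  have h1 := congrFun h0 0
  have h2 := congrFun h0 1
  have h3 := congrFun h0 2
  rcases h with h | h | h <;> simp_all

/-- The projective point with homogeneous coordinates `(a : b : c)`. -/
def mkPoint (a b c : ℂ) (h : a ≠ 0 ∨ b ≠ 0 ∨ c ≠ 0) : ProjPoint :=
  Projectivization.mk ℂ ![a, b, c] (vec_ne_zero h)

/-- The full monomial line arrangement `A(m-2,1,3)`, defined by the equation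
`xyz(x^{m-2}-y^{m-2})(y^{m-2}-z^{m-2})(x^{m-2}-z^{m-2}) = 0`: it consists of the three
coordinate lines together with the lines `x = ζ y`, `y = ζ z`, `x = ζ z` for `ζ`
ranging over the `(m-2)`-nd roots of unity. -/
def monomialArr (m : ℕ) : Finset ProjLine :=
  {mkLine 1 0 0 (Or.inl one_ne_zero), mkLine 0 1 0 (Or.inr (Or.inl one_ne_zero)),
    mkLine 0 0 1 (Or.inr (Or.inr one_ne_zero))} ∪
  ((Polynomial.nthRoots (m - 2) (1 : ℂ)).toFinset.image fun ζ =>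
    mkLine 1 (-ζ) 0 (Or.inl one_ne_zero)) ∪
  ((Polynomial.nthRoots (m - 2) (1 : ℂ)).toFinset.image fun ζ =>
    mkLine 0 1 (-ζ) (Or.inr (Or.inl one_ne_zero))) ∪
  ((Polynomial.nthRoots (m - 2) (1 : ℂ)).toFinset.image fun ζ =>
    mkLine 1 0 (-ζ) (Or.inl one_ne_zero))


lemma aux_on (p : ProjPoint) (a b c : ℂ) (h : a ≠ 0 ∨ b ≠ 0 ∨ c ≠ 0) :
    PointOnLine p (mkLine a b c h) ↔ a * p.rep 0 + b * p.rep 1 + c * p.rep 2 = 0 := by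
  unfold PointOnLine mkLine
  obtain ⟨u, hu⟩ := Projectivization.exists_smul_eq_mk_rep ℂ (mkForm a b c) (mkForm_ne_zero h)
  rw [← hu, ← mkForm_apply]
  simp [Units.smul_def]

lemma aux_rep (a b c : ℂ) (h : a ≠ 0 ∨ b ≠ 0 ∨ c ≠ 0) :
    ∃ u : ℂ, u ≠ 0 ∧ (mkPoint a b c h).rep 0 = u * a ∧ (mkPoint a b c h).rep 1 = u * b ∧
      (mkPoint a b c h).rep 2 = u * c := by
  unfold mkPoint
  obtain ⟨u, hu⟩ := Projectivization.exists_smul_eq_mk_rep ℂ ![a, b, c] (vec_ne_zero h)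
  refine ⟨u, u.ne_zero, ?_⟩
  rw [← hu]
  simp [Units.smul_def]

lemma aux_point_on (x y z : ℂ) (hp : x ≠ 0 ∨ y ≠ 0 ∨ z ≠ 0)
    (a b c : ℂ) (h : a ≠ 0 ∨ b ≠ 0 ∨ c ≠ 0) :
    PointOnLine (mkPoint x y z hp) (mkLine a b c h) ↔ a * x + b * y + c * z = 0 := by
  rw [aux_on]
  obtain ⟨u, hu, h0, h1, h2⟩ := aux_rep x y z hp
  rw [h0, h1, h2]
  have : a * (u * x) + b * (u * y) + c * (u * z) = u * (a * x + b * y + c * z) := by ring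
  rw [this]
  simp [hu]

lemma aux_line_eq {a b c a' b' c' : ℂ} {h : a ≠ 0 ∨ b ≠ 0 ∨ c ≠ 0}
    {h' : a' ≠ 0 ∨ b' ≠ 0 ∨ c' ≠ 0} (e : mkLine a b c h = mkLine a' b' c' h') :
    a * b' = a' * b ∧ a * c' = a' * c ∧ b * c' = b' * c := by
  unfold mkLine at e
  rw [Projectivization.mk_eq_mk_iff'] at e
  obtain ⟨u, hu⟩ := e
  have h1 := congrArg (fun φ => φ (Pi.single 0 1)) hu
  have h2 := congrArg (fun φ => φ (Pi.single 1 1)) hu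
  have h3 := congrArg (fun φ => φ (Pi.single 2 1)) hu
  simp [mkForm_apply] at h1 h2 h3
  subst h1 h2 h3
  refine ⟨?_, ?_, ?_⟩ <;> ring

/-- A point whose representative is proportional to `(a, b, c)` is `mkPoint a b c`. -/
lemma aux_eq_mkPoint (p : ProjPoint) (a b c u : ℂ) (h : a ≠ 0 ∨ b ≠ 0 ∨ c ≠ 0)
    (h0 : p.rep 0 = u * a) (h1 : p.rep 1 = u * b) (h2 : p.rep 2 = u * c) :
    p = mkPoint a b c h := by
  rw [← p.mk_rep]
  unfold mkPoint
  rw [Projectivization.mk_eq_mk_iff']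
  refine ⟨u, ?_⟩
  ext i
  fin_cases i <;> simp [h0, h1, h2]

/-- The three coordinate lines and the three families of lines. -/
abbrev auxX : ProjLine := mkLine 1 0 0 (Or.inl one_ne_zero)
abbrev auxY : ProjLine := mkLine 0 1 0 (Or.inr (Or.inl one_ne_zero))
abbrev auxZ : ProjLine := mkLine 0 0 1 (Or.inr (Or.inr one_ne_zero))
abbrev auxA (ζ : ℂ) : ProjLine := mkLine 1 (-ζ) 0 (Or.inl one_ne_zero)
abbrev auxB (ζ : ℂ) : ProjLine := mkLine 0 1 (-ζ) (Or.inr (Or.inl one_ne_zero))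
abbrev auxC (ζ : ℂ) : ProjLine := mkLine 1 0 (-ζ) (Or.inl one_ne_zero)

/-- The roots of unity. -/
abbrev auxR (m : ℕ) : Finset ℂ := (Polynomial.nthRoots (m - 2) (1 : ℂ)).toFinset

lemma aux_mem_R {m : ℕ} (hm : 3 ≤ m) (ζ : ℂ) : ζ ∈ auxR m ↔ ζ ^ (m - 2) = 1 := by
  rw [Multiset.mem_toFinset, Polynomial.mem_nthRoots (by omega)]

lemma aux_card_R {m : ℕ} (hm : 3 ≤ m) : (auxR m).card = m - 2 := by
  have h := Complex.isPrimitiveRoot_exp (m - 2) (by omega)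
  rw [Multiset.toFinset_card_of_nodup h.nthRoots_one_nodup, h.card_nthRoots_one]

lemma aux_one_R {m : ℕ} (hm : 3 ≤ m) : (1 : ℂ) ∈ auxR m := by
  rw [aux_mem_R hm]; simp

lemma aux_ne_zero {m : ℕ} (hm : 3 ≤ m) {ζ : ℂ} (h : ζ ∈ auxR m) : ζ ≠ 0 := by
  rw [aux_mem_R hm] at h
  rintro rfl
  rw [zero_pow (by omega)] at h
  exact zero_ne_one h

lemma aux_div {m : ℕ} (hm : 3 ≤ m) {ζ η : ℂ} (h : ζ ∈ auxR m) (h' : η ∈ auxR m) :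
    ζ / η ∈ auxR m := by
  rw [aux_mem_R hm] at *
  rw [div_pow, h, h', div_one]

lemma aux_mul {m : ℕ} (hm : 3 ≤ m) {ζ η : ℂ} (h : ζ ∈ auxR m) (h' : η ∈ auxR m) :
    ζ * η ∈ auxR m := by
  rw [aux_mem_R hm] at *
  rw [mul_pow, h, h', one_mul]

lemma aux_mem {m : ℕ} (L : ProjLine) : L ∈ monomialArr m ↔
    L = auxX ∨ L = auxY ∨ L = auxZ ∨ (∃ ζ ∈ auxR m, L = auxA ζ) ∨
      (∃ ζ ∈ auxR m, L = auxB ζ) ∨ (∃ ζ ∈ auxR m, L = auxC ζ) := by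
  simp only [monomialArr, Finset.mem_union, Finset.mem_insert, Finset.mem_singleton,
    Finset.mem_image, or_assoc, eq_comm (b := L)]

lemma aux_cardA (S : Finset ℂ) : (S.image auxA).card = S.card :=
  Finset.card_image_of_injective _ fun x y e => by simpa using (aux_line_eq e).1.symm

lemma aux_cardB (S : Finset ℂ) : (S.image auxB).card = S.card :=
  Finset.card_image_of_injective _ fun x y e => by simpa using (aux_line_eq e).2.2.symm

lemma aux_cardC (S : Finset ℂ) : (S.image auxC).card = S.card :=
  Finset.card_image_of_injective _ fun x y e => by simpa using (aux_line_eq e).2.1.symm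

lemma aux_inter (m : ℕ) (p : ProjPoint) (h : IsIntersectionPoint (monomialArr m) p) :
    ∃ L₁ L₂, L₁ ∈ monomialArr m ∧ L₂ ∈ monomialArr m ∧ PointOnLine p L₁ ∧ PointOnLine p L₂ ∧
      L₁ ≠ L₂ := by
  unfold IsIntersectionPoint mult at h
  have hf : Set.Finite {L : ProjLine | L ∈ monomialArr m ∧ PointOnLine p L} :=
    (monomialArr m).finite_toSet.subset fun L hL => hL.1
  obtain ⟨L₁, L₂, h₁, h₂, hne⟩ := (Set.one_lt_ncard_iff hf).1 h
  exact ⟨L₁, L₂, h₁.1, h₂.1, h₁.2, h₂.2, hne⟩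

lemma aux_inter' (m : ℕ) (p : ProjPoint) (L₁ L₂ : ProjLine) (h₁ : L₁ ∈ monomialArr m)
    (h₂ : L₂ ∈ monomialArr m) (h₁' : PointOnLine p L₁) (h₂' : PointOnLine p L₂)
    (hne : L₁ ≠ L₂) : IsIntersectionPoint (monomialArr m) p := by
  unfold IsIntersectionPoint mult
  have hf : Set.Finite {L : ProjLine | L ∈ monomialArr m ∧ PointOnLine p L} :=
    (monomialArr m).finite_toSet.subset fun L hL => hL.1
  exact (Set.one_lt_ncard_iff hf).2 ⟨L₁, L₂, ⟨h₁, h₁'⟩, ⟨h₂, h₂'⟩, hne⟩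

lemma aux_card {m : ℕ} (hm : 3 ≤ m) : (monomialArr m).card = 3 * m - 3 := by
  have e : monomialArr m = {auxX, auxY, auxZ} ∪ (auxR m).image auxA ∪ (auxR m).image auxB ∪
      (auxR m).image auxC := rfl
  rw [e, Finset.card_union_of_disjoint, Finset.card_union_of_disjoint,
    Finset.card_union_of_disjoint, aux_cardA, aux_cardB, aux_cardC, aux_card_R hm,
    Finset.card_insert_of_notMem, Finset.card_insert_of_notMem, Finset.card_singleton]
  · omega
  · intro h
    simp only [Finset.mem_singleton] at h
    simpa using aux_line_eq h
  · intro h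
    simp only [Finset.mem_insert, Finset.mem_singleton] at h
    rcases h with h | h <;> simpa using aux_line_eq h
  · rw [Finset.disjoint_left]
    intro L h1 h2
    simp only [Finset.mem_insert, Finset.mem_singleton, Finset.mem_image] at h1 h2
    obtain ⟨ζ, hζ, rfl⟩ := h2
    have := aux_ne_zero hm hζ
    rcases h1 with h | h | h <;> simpa [this] using aux_line_eq h
  · rw [Finset.disjoint_left]
    intro L h1 h2
    simp only [Finset.mem_union, Finset.mem_insert, Finset.mem_singleton, Finset.mem_image] at h1 h2
    obtain ⟨ζ, hζ, rfl⟩ := h2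
    have := aux_ne_zero hm hζ
    rcases h1 with (h | h | h) | ⟨η, hη, h⟩ <;> simpa [this] using aux_line_eq h
  · rw [Finset.disjoint_left]
    intro L h1 h2
    simp only [Finset.mem_union, Finset.mem_insert, Finset.mem_singleton, Finset.mem_image] at h1 h2
    obtain ⟨ζ, hζ, rfl⟩ := h2
    have := aux_ne_zero hm hζ
    rcases h1 with ((h | h | h) | ⟨η, hη, h⟩) | ⟨η, hη, h⟩ <;>
      simpa [this] using aux_line_eq h

lemma aux_mult (m : ℕ) (p : ProjPoint) (S : Finset ProjLine)
    (h : ∀ L, (L ∈ monomialArr m ∧ PointOnLine p L) ↔ L ∈ S) :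
    mult (monomialArr m) p = S.card := by
  unfold mult
  rw [← Set.ncard_coe_finset]
  congr 1
  ext L
  exact h L

lemma aux_mult_pencil {m : ℕ} (hm : 3 ≤ m) (p : ProjPoint) (L₁ L₂ : ProjLine)
    (f : ℂ → ProjLine) (hf : ((auxR m).image f).card = (auxR m).card)
    (h12 : L₁ ≠ L₂) (h1 : ∀ ζ ∈ auxR m, L₁ ≠ f ζ) (h2 : ∀ ζ ∈ auxR m, L₂ ≠ f ζ)
    (h : ∀ L, (L ∈ monomialArr m ∧ PointOnLine p L) ↔
      (L = L₁ ∨ L = L₂ ∨ ∃ ζ ∈ auxR m, L = f ζ)) :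
    mult (monomialArr m) p = m := by
  rw [aux_mult m p (insert L₁ (insert L₂ ((auxR m).image f))), Finset.card_insert_of_notMem,
    Finset.card_insert_of_notMem, hf, aux_card_R hm]
  · omega
  · simp only [Finset.mem_image, not_exists, not_and]
    exact fun ζ hζ e => h2 ζ hζ e.symm
  · simp only [Finset.mem_insert, Finset.mem_image, not_or, not_exists, not_and]
    exact ⟨h12, fun ζ hζ e => h1 ζ hζ e.symm⟩
  · intro L
    rw [h]
    simp only [Finset.mem_insert, Finset.mem_image, eq_comm (b := L)]

lemma aux_mult_x {m : ℕ} (hm : 3 ≤ m) :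
    mult (monomialArr m) (mkPoint 1 0 0 (Or.inl one_ne_zero)) = m := by
  apply aux_mult_pencil hm _ auxY auxZ auxB (aux_cardB _)
  · intro h; simpa using aux_line_eq h
  · intro ζ hζ h; have := aux_ne_zero hm hζ; simpa [this] using aux_line_eq h
  · intro ζ hζ h; simpa using aux_line_eq h
  · intro L
    rw [aux_mem]
    constructor
    · rintro ⟨rfl | rfl | rfl | ⟨ζ, hζ, rfl⟩ | ⟨ζ, hζ, rfl⟩ | ⟨ζ, hζ, rfl⟩, h⟩ <;>
        rw [aux_point_on] at h <;> simp at h ⊢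
      exact Or.inr (Or.inr ⟨ζ, by simpa using hζ, rfl⟩)
    · rintro (rfl | rfl | ⟨ζ, hζ, rfl⟩) <;> rw [aux_point_on] <;> simp
      right; right; right; right; left
      exact ⟨ζ, by simpa using hζ, rfl⟩

lemma aux_mult_y {m : ℕ} (hm : 3 ≤ m) :
    mult (monomialArr m) (mkPoint 0 1 0 (Or.inr (Or.inl one_ne_zero))) = m := by
  apply aux_mult_pencil hm _ auxX auxZ auxC (aux_cardC _)
  · intro h; simpa using aux_line_eq h
  · intro ζ hζ h; have := aux_ne_zero hm hζ; simpa [this] using aux_line_eq h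
  · intro ζ hζ h; simpa using aux_line_eq h
  · intro L
    rw [aux_mem]
    constructor
    · rintro ⟨h' | h' | h' | ⟨ζ, hζ, h'⟩ | ⟨ζ, hζ, h'⟩ | ⟨ζ, hζ, h'⟩, h⟩ <;>
        rw [h', aux_point_on] at h <;> simp at h
      · exact Or.inl h'
      · exact Or.inr (Or.inl h')
      · exact absurd h (aux_ne_zero hm hζ)
      · exact Or.inr (Or.inr ⟨ζ, hζ, h'⟩)
    · rintro (h' | h' | ⟨ζ, hζ, h'⟩) <;> refine ⟨?_, ?_⟩
      · tauto
      · rw [h', aux_point_on]; simp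
      · tauto
      · rw [h', aux_point_on]; simp
      · exact Or.inr (Or.inr (Or.inr (Or.inr (Or.inr ⟨ζ, hζ, h'⟩))))
      · rw [h', aux_point_on]; simp

lemma aux_mult_z {m : ℕ} (hm : 3 ≤ m) :
    mult (monomialArr m) (mkPoint 0 0 1 (Or.inr (Or.inr one_ne_zero))) = m := by
  apply aux_mult_pencil hm _ auxX auxY auxA (aux_cardA _)
  · intro h; simpa using aux_line_eq h
  · intro ζ hζ h; have := aux_ne_zero hm hζ; simpa [this] using aux_line_eq h
  · intro ζ hζ h; simpa using aux_line_eq h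
  · intro L
    rw [aux_mem]
    constructor
    · rintro ⟨h' | h' | h' | ⟨ζ, hζ, h'⟩ | ⟨ζ, hζ, h'⟩ | ⟨ζ, hζ, h'⟩, h⟩ <;>
        rw [h', aux_point_on] at h <;> simp at h
      · exact Or.inl h'
      · exact Or.inr (Or.inl h')
      · exact Or.inr (Or.inr ⟨ζ, hζ, h'⟩)
      · exact absurd h (aux_ne_zero hm hζ)
      · exact absurd h (aux_ne_zero hm hζ)
    · rintro (h' | h' | ⟨ζ, hζ, h'⟩) <;> refine ⟨?_, ?_⟩
      · tauto
      · rw [h', aux_point_on]; simp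
      · tauto
      · rw [h', aux_point_on]; simp
      · exact Or.inr (Or.inr (Or.inr (Or.inl ⟨ζ, hζ, h'⟩)))
      · rw [h', aux_point_on]; simp

/-- The equation satisfied by a point on a line of the arrangement. -/
lemma aux_class {m : ℕ} (p : ProjPoint) (L : ProjLine) (hL : L ∈ monomialArr m)
    (h : PointOnLine p L) :
    (L = auxX ∧ p.rep 0 = 0) ∨ (L = auxY ∧ p.rep 1 = 0) ∨ (L = auxZ ∧ p.rep 2 = 0) ∨
    (∃ ζ ∈ auxR m, L = auxA ζ ∧ p.rep 0 = ζ * p.rep 1) ∨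
    (∃ ζ ∈ auxR m, L = auxB ζ ∧ p.rep 1 = ζ * p.rep 2) ∨
    (∃ ζ ∈ auxR m, L = auxC ζ ∧ p.rep 0 = ζ * p.rep 2) := by
  rw [aux_mem] at hL
  rcases hL with h' | h' | h' | ⟨ζ, hζ, h'⟩ | ⟨ζ, hζ, h'⟩ | ⟨ζ, hζ, h'⟩ <;>
    rw [h', aux_on] at h
  · left; exact ⟨h', by linear_combination h⟩
  · right; left; exact ⟨h', by linear_combination h⟩
  · right; right; left; exact ⟨h', by linear_combination h⟩
  · right; right; right; left; exact ⟨ζ, hζ, h', by linear_combination h⟩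
  · right; right; right; right; left; exact ⟨ζ, hζ, h', by linear_combination h⟩
  · right; right; right; right; right; exact ⟨ζ, hζ, h', by linear_combination h⟩

lemma aux_rep_ne (p : ProjPoint) : p.rep 0 ≠ 0 ∨ p.rep 1 ≠ 0 ∨ p.rep 2 ≠ 0 := by
  by_contra h
  push Not at h
  apply p.rep_nonzero
  ext i
  fin_cases i <;> simp [h]

lemma aux_rel_x {m : ℕ} (hm : 3 ≤ m) (q : ProjPoint) (h : IsIntersectionPoint (monomialArr m) q) :
    q.rep 1 = 0 ∨ q.rep 2 = 0 ∨ ∃ ζ ∈ auxR m, q.rep 1 = ζ * q.rep 2 := by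
  by_contra! hc
  obtain ⟨c1, c2, c3⟩ := hc
  obtain ⟨L₁, L₂, h₁, h₂, p₁, p₂, hne⟩ := aux_inter m q h
  have k₁ := aux_class q L₁ h₁ p₁
  have k₂ := aux_class q L₂ h₂ p₂
  simp only [c1, c2, and_false, false_or] at k₁ k₂
  rcases k₁ with ⟨l₁, e₁⟩ | ⟨ζ, hζ, l₁, e₁⟩ | ⟨ζ, hζ, l₁, e₁⟩ | ⟨ζ, hζ, l₁, e₁⟩ <;>
  rcases k₂ with ⟨l₂, e₂⟩ | ⟨η, hη, l₂, e₂⟩ | ⟨η, hη, l₂, e₂⟩ | ⟨η, hη, l₂, e₂⟩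
  all_goals first
    | exact c3 _ hη e₂
    | exact c3 _ hζ e₁
    | (exact hne (l₁.trans l₂.symm))
    | skip
  · rw [e₁] at e₂; simp_all [aux_ne_zero hm hη]
  · rw [e₁] at e₂; simp_all [aux_ne_zero hm hη]
  · rw [e₂] at e₁; simp_all [aux_ne_zero hm hζ]
  · rw [e₁] at e₂; exact hne (by rw [l₁, l₂, mul_right_cancel₀ c1 e₂])
  · refine c3 _ (aux_div hm hη hζ) ?_
    have := aux_ne_zero hm hζ
    field_simp
    linear_combination e₂ - e₁
  · rw [e₂] at e₁; simp_all [aux_ne_zero hm hζ]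
  · refine c3 _ (aux_div hm hζ hη) ?_
    have := aux_ne_zero hm hη
    field_simp
    linear_combination e₁ - e₂
  · rw [e₁] at e₂; exact hne (by rw [l₁, l₂, mul_right_cancel₀ c2 e₂])

lemma aux_rel_y {m : ℕ} (hm : 3 ≤ m) (q : ProjPoint) (h : IsIntersectionPoint (monomialArr m) q) :
    q.rep 0 = 0 ∨ q.rep 2 = 0 ∨ ∃ ζ ∈ auxR m, q.rep 0 = ζ * q.rep 2 := by
  by_contra! hc
  obtain ⟨c1, c2, c3⟩ := hc
  obtain ⟨L₁, L₂, h₁, h₂, p₁, p₂, hne⟩ := aux_inter m q h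
  have k₁ := aux_class q L₁ h₁ p₁
  have k₂ := aux_class q L₂ h₂ p₂
  simp only [c1, c2, and_false, false_or] at k₁ k₂
  rcases aux_rel_x hm q h with h1 | h1 | ⟨ζ, hζ, h1⟩
  · rcases k₁ with ⟨l₁, e₁⟩ | ⟨ζ, hζ, l₁, e₁⟩ | ⟨ζ, hζ, l₁, e₁⟩ | ⟨ζ, hζ, l₁, e₁⟩
    · rcases k₂ with ⟨l₂, e₂⟩ | ⟨η, hη, l₂, e₂⟩ | ⟨η, hη, l₂, e₂⟩ | ⟨η, hη, l₂, e₂⟩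
      · exact hne (l₁.trans l₂.symm)
      · simp [h1, c1] at e₂
      · simp [h1, c2, aux_ne_zero hm hη] at e₂
      · exact c3 _ hη e₂
    · simp [h1, c1] at e₁
    · simp [h1, c2, aux_ne_zero hm hζ] at e₁
    · exact c3 _ hζ e₁
  · exact c2 h1
  · have hz := aux_ne_zero hm hζ
    have h10 : q.rep 1 ≠ 0 := by rw [h1]; exact mul_ne_zero hz c2
    simp only [h10, and_false, false_or] at k₁ k₂
    rcases k₁ with ⟨η, hη, l₁, e₁⟩ | ⟨η, hη, l₁, e₁⟩ | ⟨η, hη, l₁, e₁⟩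
    · exact c3 _ (aux_mul hm hη hζ) (by rw [e₁, h1]; ring)
    · rcases k₂ with ⟨ξ, hξ, l₂, e₂⟩ | ⟨ξ, hξ, l₂, e₂⟩ | ⟨ξ, hξ, l₂, e₂⟩
      · exact c3 _ (aux_mul hm hξ hζ) (by rw [e₂, h1]; ring)
      · rw [e₁] at e₂; exact hne (by rw [l₁, l₂, mul_right_cancel₀ c2 e₂])
      · exact c3 _ hξ e₂
    · exact c3 _ hη e₁

lemma aux_rel_z {m : ℕ} (hm : 3 ≤ m) (q : ProjPoint) (h : IsIntersectionPoint (monomialArr m) q) :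
    q.rep 0 = 0 ∨ q.rep 1 = 0 ∨ ∃ ζ ∈ auxR m, q.rep 0 = ζ * q.rep 1 := by
  by_contra! hc
  obtain ⟨c1, c2, c3⟩ := hc
  by_cases c0 : q.rep 2 = 0
  · obtain ⟨L₁, L₂, h₁, h₂, p₁, p₂, hne⟩ := aux_inter m q h
    have k₁ := aux_class q L₁ h₁ p₁
    have k₂ := aux_class q L₂ h₂ p₂
    simp only [c0, c1, c2, mul_zero, and_false, false_or, or_false, exists_false, and_true] at k₁ k₂
    rcases k₁ with l₁ | ⟨ζ, hζ, l₁, e₁⟩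
    · rcases k₂ with l₂ | ⟨ζ, hζ, l₂, e₂⟩
      · exact hne (l₁.trans l₂.symm)
      · exact c3 _ hζ e₂
    · exact c3 _ hζ e₁
  · obtain ⟨ζ, hζ, h1⟩ := ((aux_rel_x hm q h).resolve_left c2).resolve_left c0
    obtain ⟨η, hη, h2⟩ := ((aux_rel_y hm q h).resolve_left c1).resolve_left c0
    refine c3 _ (aux_div hm hη hζ) ?_
    have := aux_ne_zero hm hζ
    rw [h1, h2]
    field_simp

lemma aux_mod_x {m : ℕ} (hm : 3 ≤ m) :
    IsModular (monomialArr m) (mkPoint 1 0 0 (Or.inl one_ne_zero)) := by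
  refine ⟨?_, fun q hq _ => ?_⟩
  · unfold IsIntersectionPoint; rw [aux_mult_x hm]; omega
  · rcases aux_rel_x hm q hq with h | h | ⟨ζ, hζ, h⟩
    · exact ⟨auxY, by rw [aux_mem]; tauto, by rw [aux_point_on]; simp, by rw [aux_on]; simp [h]⟩
    · exact ⟨auxZ, by rw [aux_mem]; tauto, by rw [aux_point_on]; simp, by rw [aux_on]; simp [h]⟩
    · exact ⟨auxB ζ, by rw [aux_mem]; exact Or.inr (Or.inr (Or.inr (Or.inr (Or.inl ⟨ζ, hζ, rfl⟩)))),
        by rw [aux_point_on]; simp, by rw [aux_on]; simp [h]⟩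

lemma aux_mod_y {m : ℕ} (hm : 3 ≤ m) :
    IsModular (monomialArr m) (mkPoint 0 1 0 (Or.inr (Or.inl one_ne_zero))) := by
  refine ⟨?_, fun q hq _ => ?_⟩
  · unfold IsIntersectionPoint; rw [aux_mult_y hm]; omega
  · rcases aux_rel_y hm q hq with h | h | ⟨ζ, hζ, h⟩
    · exact ⟨auxX, by rw [aux_mem]; tauto, by rw [aux_point_on]; simp, by rw [aux_on]; simp [h]⟩
    · exact ⟨auxZ, by rw [aux_mem]; tauto, by rw [aux_point_on]; simp, by rw [aux_on]; simp [h]⟩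
    · exact ⟨auxC ζ, by rw [aux_mem]; exact Or.inr (Or.inr (Or.inr (Or.inr (Or.inr ⟨ζ, hζ, rfl⟩)))),
        by rw [aux_point_on]; simp, by rw [aux_on]; simp [h]⟩

lemma aux_mod_z {m : ℕ} (hm : 3 ≤ m) :
    IsModular (monomialArr m) (mkPoint 0 0 1 (Or.inr (Or.inr one_ne_zero))) := by
  refine ⟨?_, fun q hq _ => ?_⟩
  · unfold IsIntersectionPoint; rw [aux_mult_z hm]; omega
  · rcases aux_rel_z hm q hq with h | h | ⟨ζ, hζ, h⟩
    · exact ⟨auxX, by rw [aux_mem]; tauto, by rw [aux_point_on]; simp, by rw [aux_on]; simp [h]⟩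
    · exact ⟨auxY, by rw [aux_mem]; tauto, by rw [aux_point_on]; simp, by rw [aux_on]; simp [h]⟩
    · exact ⟨auxA ζ, by rw [aux_mem]; exact Or.inr (Or.inr (Or.inr (Or.inl ⟨ζ, hζ, rfl⟩))),
        by rw [aux_point_on]; simp, by rw [aux_on]; simp [h]⟩

/-- A modular point satisfies one of the two equations of the lines through `(0 : ζ : 1)`. -/
lemma aux_test_x {m : ℕ} (hm : 3 ≤ m) (p : ProjPoint) (hp : IsModular (monomialArr m) p)
    (ζ : ℂ) (hζ : ζ ∈ auxR m) : p.rep 0 = 0 ∨ p.rep 1 = ζ * p.rep 2 := by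
  have z0 := aux_ne_zero hm hζ
  by_cases hq : mkPoint 0 ζ 1 (Or.inr (Or.inr one_ne_zero)) = p
  · subst hq
    obtain ⟨u, -, h0, -, -⟩ := aux_rep 0 ζ 1 (Or.inr (Or.inr one_ne_zero))
    left; rw [h0, mul_zero]
  obtain ⟨L, hL, hpL, hqL⟩ := hp.2 _ (aux_inter' m _ auxX (auxB ζ) (by rw [aux_mem]; tauto)
    (by rw [aux_mem]; exact Or.inr (Or.inr (Or.inr (Or.inr (Or.inl ⟨ζ, hζ, rfl⟩)))))
    (by rw [aux_point_on]; simp) (by rw [aux_point_on]; simp)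
    (fun h => by simpa using aux_line_eq h)) hq
  rcases aux_class p L hL hpL with ⟨l, e⟩ | ⟨l, e⟩ | ⟨l, e⟩ | ⟨η, hη, l, e⟩ | ⟨η, hη, l, e⟩ |
    ⟨η, hη, l, e⟩ <;> rw [l, aux_point_on] at hqL
  · exact Or.inl e
  · simp [z0] at hqL
  · simp at hqL
  · simp [z0, aux_ne_zero hm hη] at hqL
  · have : ζ = η := by linear_combination hqL
    rw [this]; exact Or.inr e
  · simp [aux_ne_zero hm hη] at hqL

lemma aux_test_y {m : ℕ} (hm : 3 ≤ m) (p : ProjPoint) (hp : IsModular (monomialArr m) p) :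
    p.rep 1 = 0 ∨ p.rep 0 = p.rep 2 := by
  have hζ := aux_one_R hm
  by_cases hq : mkPoint 1 0 1 (Or.inl one_ne_zero) = p
  · subst hq
    obtain ⟨u, -, -, h0, -⟩ := aux_rep 1 0 1 (Or.inl one_ne_zero)
    left; rw [h0, mul_zero]
  obtain ⟨L, hL, hpL, hqL⟩ := hp.2 _ (aux_inter' m _ auxY (auxC 1) (by rw [aux_mem]; tauto)
    (by rw [aux_mem]; exact Or.inr (Or.inr (Or.inr (Or.inr (Or.inr ⟨1, hζ, rfl⟩)))))
    (by rw [aux_point_on]; simp) (by rw [aux_point_on]; simp)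
    (fun h => by simpa using aux_line_eq h)) hq
  rcases aux_class p L hL hpL with ⟨l, e⟩ | ⟨l, e⟩ | ⟨l, e⟩ | ⟨η, hη, l, e⟩ | ⟨η, hη, l, e⟩ |
    ⟨η, hη, l, e⟩ <;> rw [l, aux_point_on] at hqL
  · simp at hqL
  · exact Or.inl e
  · simp at hqL
  · simp at hqL
  · simp [aux_ne_zero hm hη] at hqL
  · have : η = 1 := by linear_combination -hqL
    rw [this, one_mul] at e; exact Or.inr e

lemma aux_test_z {m : ℕ} (hm : 3 ≤ m) (p : ProjPoint) (hp : IsModular (monomialArr m) p) :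
    p.rep 2 = 0 ∨ p.rep 0 = p.rep 1 := by
  have hζ := aux_one_R hm
  by_cases hq : mkPoint 1 1 0 (Or.inl one_ne_zero) = p
  · subst hq
    obtain ⟨u, -, -, -, h0⟩ := aux_rep 1 1 0 (Or.inl one_ne_zero)
    left; rw [h0, mul_zero]
  obtain ⟨L, hL, hpL, hqL⟩ := hp.2 _ (aux_inter' m _ auxZ (auxA 1) (by rw [aux_mem]; tauto)
    (by rw [aux_mem]; exact Or.inr (Or.inr (Or.inr (Or.inl ⟨1, hζ, rfl⟩))))
    (by rw [aux_point_on]; simp) (by rw [aux_point_on]; simp)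
    (fun h => by simpa using aux_line_eq h)) hq
  rcases aux_class p L hL hpL with ⟨l, e⟩ | ⟨l, e⟩ | ⟨l, e⟩ | ⟨η, hη, l, e⟩ | ⟨η, hη, l, e⟩ |
    ⟨η, hη, l, e⟩ <;> rw [l, aux_point_on] at hqL
  · simp at hqL
  · simp at hqL
  · exact Or.inl e
  · have : η = 1 := by linear_combination -hqL
    rw [this, one_mul] at e; exact Or.inr e
  · simp at hqL
  · simp at hqL

lemma aux_mult_one (p : ProjPoint) (h0 : p.rep 0 ≠ 0) (h1 : p.rep 1 = p.rep 0)
    (h2 : p.rep 2 = p.rep 0) : mult (monomialArr 3) p = 3 := by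
  have hR : ∀ ζ, ζ ∈ auxR 3 ↔ ζ = 1 := fun ζ => by rw [aux_mem_R le_rfl]; simp
  rw [aux_mult 3 p {auxA 1, auxB 1, auxC 1}, Finset.card_insert_of_notMem,
    Finset.card_insert_of_notMem, Finset.card_singleton]
  · intro h
    simp only [Finset.mem_singleton] at h
    simpa using aux_line_eq h
  · intro h
    simp only [Finset.mem_insert, Finset.mem_singleton] at h
    rcases h with h | h <;> simpa using aux_line_eq h
  · intro L
    simp only [Finset.mem_insert, Finset.mem_singleton]
    constructor
    · rintro ⟨hL, hp⟩
      have := aux_class p L hL hp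
      simp only [hR, h0, h1, h2, and_false, false_or, exists_eq_left] at this
      tauto
    · intro h
      refine ⟨?_, ?_⟩
      · rw [aux_mem]
        simp only [hR, exists_eq_left]
        tauto
      · rcases h with h | h | h <;> rw [h, aux_on, h1, h2] <;> ring

lemma aux_all {m : ℕ} (hm : 3 ≤ m) (p : ProjPoint) (hp : IsModular (monomialArr m) p) :
    mult (monomialArr m) p = m := by
  have tx := aux_test_x hm p hp
  have tx1 := tx 1 (aux_one_R hm)
  rw [one_mul] at tx1
  have ty := aux_test_y hm p hp
  have tz := aux_test_z hm p hp
  have hne := aux_rep_ne p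
  by_cases c0 : p.rep 0 = 0
  · by_cases c1 : p.rep 1 = 0
    · rw [aux_eq_mkPoint p 0 0 1 (p.rep 2) (Or.inr (Or.inr one_ne_zero)) (by simp [c0])
        (by simp [c1]) (by simp), aux_mult_z hm]
    · have c2 : p.rep 2 = 0 := by rw [← ty.resolve_left c1, c0]
      rw [aux_eq_mkPoint p 0 1 0 (p.rep 1) (Or.inr (Or.inl one_ne_zero)) (by simp [c0])
        (by simp) (by simp [c2]), aux_mult_y hm]
  · have e := tx1.resolve_left c0
    by_cases c1 : p.rep 1 = 0
    · rw [aux_eq_mkPoint p 1 0 0 (p.rep 0) (Or.inl one_ne_zero) (by simp)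
        (by simp [c1]) (by simp [← e, c1]), aux_mult_x hm]
    · have e' := ty.resolve_left c1
      have hR : ∀ ζ ∈ auxR m, ζ = 1 := by
        intro ζ hζ
        have := (tx ζ hζ).resolve_left c0
        rw [e, ← e'] at this
        exact mul_right_cancel₀ c0 (by rw [one_mul]; exact this.symm)
      have hc : (auxR m).card ≤ 1 :=
        Finset.card_le_one.2 fun a ha b hb => (hR a ha).trans (hR b hb).symm
      rw [aux_card_R hm] at hc
      obtain rfl : m = 3 := by omega
      exact aux_mult_one p c0 (e.trans e'.symm) e'.symm

/-- For `m ≥ 3`, the full monomial arrangement `A(m-2,1,3)` has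
exactly `3m - 3` lines, the three coordinate points are modular points of
multiplicity `m`, every modular point has multiplicity `m`; in particular
`A(m-2,1,3)` is an `m`-homogeneous supersolvable arrangement with `3m - 3` lines. -/
theorem monomialArr_is_m_homogeneous (m : ℕ) (hm : 3 ≤ m) :
    (monomialArr m).card = 3 * m - 3 ∧
    (IsModular (monomialArr m) (mkPoint 1 0 0 (Or.inl one_ne_zero)) ∧
      mult (monomialArr m) (mkPoint 1 0 0 (Or.inl one_ne_zero)) = m) ∧
    (IsModular (monomialArr m) (mkPoint 0 1 0 (Or.inr (Or.inl one_ne_zero))) ∧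
      mult (monomialArr m) (mkPoint 0 1 0 (Or.inr (Or.inl one_ne_zero))) = m) ∧
    (IsModular (monomialArr m) (mkPoint 0 0 1 (Or.inr (Or.inr one_ne_zero))) ∧
      mult (monomialArr m) (mkPoint 0 0 1 (Or.inr (Or.inr one_ne_zero))) = m) ∧
    (∀ p : ProjPoint, IsModular (monomialArr m) p → mult (monomialArr m) p = m) ∧
    IsHomogSS (monomialArr m) m := by
  exact ⟨aux_card hm, ⟨aux_mod_x hm, aux_mult_x hm⟩, ⟨aux_mod_y hm, aux_mult_y hm⟩,
    ⟨aux_mod_z hm, aux_mult_z hm⟩, fun p hp => aux_all hm p hp,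
    ⟨⟨_, aux_mod_x hm⟩, fun p hp => aux_all hm p hp⟩⟩

end
end

section
/- Let A be an m-homogeneous supersolvable line arrangement in ℙ² with m ≥ 3, having at least 3 modular points. Then A is projectively equivalent to the full monomial line arrangement A(m−2,1,3): xyz(x^{m−2}−y^{m−2})(y^{m−2}−z^{m−2})(x^{m−2}−z^{m−2}) = 0. -/
open scoped LinearAlgebra.Projectivization

noncomputable section

attribute [local instance] Classical.propDecidable

/-- The projective transformation of lines induced by a linear automorphism of `ℂ³`
(acting on defining linear forms through the inverse dual map). -/
def lineMap (T : (Fin 3 → ℂ) ≃ₗ[ℂ] (Fin 3 → ℂ)) : ProjLine → ProjLine :=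
  Projectivization.map
    (T.symm.dualMap : Module.Dual ℂ (Fin 3 → ℂ) →ₗ[ℂ] Module.Dual ℂ (Fin 3 → ℂ))
    T.symm.dualMap.injective

/-- Two line arrangements are projectively equivalent if some projective linear
transformation of `ℙ²` maps the set of lines of one onto the set of lines of the other. -/
def ProjEquiv (A B : Finset ProjLine) : Prop :=
  ∃ T : (Fin 3 → ℂ) ≃ₗ[ℂ] (Fin 3 → ℂ),
    (lineMap T) '' (↑A : Set ProjLine) = (↑B : Set ProjLine)

/-- Additive rigidity: three finite sets of the same size closed under difference. -/
lemma aux_sum (S T U : Finset ℂ) (n : ℕ) (hn : 2 ≤ n) (hS : S.card = n) (hT : T.card = n)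
    (hU : U.card = n) (h : ∀ a ∈ S, ∀ b ∈ T, b - a ∈ U) : False := by
  have key : ∀ b ∈ T, (n : ℂ) * b - ∑ a ∈ S, a = ∑ u ∈ U, u := by
    intro b hb
    have him : S.image (fun a => b - a) = U := by
      apply Finset.eq_of_subset_of_card_le
      · intro u hu
        obtain ⟨a, ha, rfl⟩ := Finset.mem_image.1 hu
        exact h a ha b hb
      · rw [Finset.card_image_of_injective _ (sub_right_injective), hS, hU]
    rw [← him, Finset.sum_image (fun x _ y _ hxy => sub_right_injective hxy),
      Finset.sum_sub_distrib, Finset.sum_const, hS, nsmul_eq_mul]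
  obtain ⟨b, hb, b', hb', hne⟩ := Finset.one_lt_card.1 (by omega : 1 < T.card)
  apply hne
  have h1 := key b hb
  have h2 := key b' hb'
  have hn0 : (n : ℂ) ≠ 0 := by exact_mod_cast (by omega : n ≠ 0)
  have : (n : ℂ) * b = n * b' := by linear_combination h1 - h2
  exact mul_left_cancel₀ hn0 this

lemma aux_pow (S U V : Finset ℂ) (n : ℕ) (hS : S.card = n)
    (hV : V.card = n) (h0 : (0 : ℂ) ∉ S) (h0U : (0 : ℂ) ∉ U) (h1 : (1 : ℂ) ∈ U)
    (h : ∀ a ∈ S, ∀ b ∈ U, b * a ∈ V) : V = S ∧ ∀ u ∈ U, u ^ n = 1 := by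
  have him : ∀ u ∈ U, S.image (fun a => u * a) = V := by
    intro u hu
    have hu0 : u ≠ 0 := fun hh => h0U (hh ▸ hu)
    apply Finset.eq_of_subset_of_card_le
    · intro w hw
      obtain ⟨a, ha, rfl⟩ := Finset.mem_image.1 hw
      exact h a ha u hu
    · rw [Finset.card_image_of_injective _ (mul_right_injective₀ hu0), hS, hV]
  have hVS : V = S := by rw [← him 1 h1]; simp
  refine ⟨hVS, fun u hu => ?_⟩
  have hu0 : u ≠ 0 := fun hh => h0U (hh ▸ hu)
  have h2 := him u hu
  have h3 : ∏ a ∈ S, a = u ^ n * ∏ a ∈ S, a := by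
    conv_lhs => rw [← hVS, ← h2]
    rw [Finset.prod_image (fun x _ y _ hxy => mul_right_injective₀ hu0 hxy),
      Finset.prod_mul_distrib, Finset.prod_const, hS]
  have h4 : ∏ a ∈ S, a ≠ 0 := Finset.prod_ne_zero_iff.2 (fun a ha hh => h0 (hh ▸ ha))
  exact mul_right_cancel₀ h4 (by rw [one_mul]; exact h3.symm)

lemma aux_roots (S : Finset ℂ) (n : ℕ) (hn : 1 ≤ n) (hS : S.card = n)
    (h : ∀ u ∈ S, u ^ n = 1) (u : ℂ) : u ∈ S ↔ u ^ n = 1 := by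
  have : S = (Polynomial.nthRoots n (1 : ℂ)).toFinset := by
    apply Finset.eq_of_subset_of_card_le
    · intro u hu
      rw [Multiset.mem_toFinset, Polynomial.mem_nthRoots hn]
      exact h u hu
    · exact (Multiset.toFinset_card_le _).trans ((Polynomial.card_nthRoots n 1).trans hS.ge)
  rw [this, Multiset.mem_toFinset, Polynomial.mem_nthRoots hn]

/-- Coefficients of the lines of the full monomial arrangement. -/
def mono (n : ℕ) (a b c : ℂ) : Prop :=
  (a ≠ 0 ∧ b = 0 ∧ c = 0) ∨ (a = 0 ∧ b ≠ 0 ∧ c = 0) ∨ (a = 0 ∧ b = 0 ∧ c ≠ 0) ∨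
  (a ≠ 0 ∧ b ≠ 0 ∧ c = 0 ∧ (-b / a) ^ n = 1) ∨
  (a = 0 ∧ b ≠ 0 ∧ c ≠ 0 ∧ (-c / b) ^ n = 1) ∨
  (a ≠ 0 ∧ b = 0 ∧ c ≠ 0 ∧ (-c / a) ^ n = 1)

lemma finset_of_ncard (S : Set ℂ) (n : ℕ) (h : S.ncard = n + 1) (h0 : (0 : ℂ) ∈ S) :
    ∃ S' : Finset ℂ, S'.card = n ∧ ∀ a, a ∈ S' ↔ a ≠ 0 ∧ a ∈ S := by
  have hf : S.Finite := Set.finite_of_ncard_pos (by omega)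
  refine ⟨hf.toFinset.erase 0, ?_, ?_⟩
  · rw [Finset.card_erase_of_mem (by simpa using h0), ← Set.ncard_eq_toFinset_card S hf]
    omega
  · intro a; simp

lemma noncollinear (G : ℂ → ℂ → ℂ → Prop) (n : ℕ) (hn : 1 ≤ n)
    (sc : ∀ k a b c, k ≠ 0 → G a b c → G (k * a) (k * b) (k * c))
    (G0 : ¬ G 0 0 0) (hX : G 1 0 0) (hY : G 0 1 0) (hZ : G 0 0 1)
    (mod0 : ∀ a b c a' b' c' x y z, G a b c → G a' b' c' →
      (∀ k, ¬ (a' = k * a ∧ b' = k * b ∧ c' = k * c)) →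
      a * x + b * y + c * z = 0 → a' * x + b' * y + c' * z = 0 →
      ∃ s t, G 0 s t ∧ s * y + t * z = 0)
    (mod1 : ∀ a b c a' b' c' x y z, G a b c → G a' b' c' →
      (∀ k, ¬ (a' = k * a ∧ b' = k * b ∧ c' = k * c)) →
      a * x + b * y + c * z = 0 → a' * x + b' * y + c' * z = 0 →
      ∃ s t, G s 0 t ∧ s * x + t * z = 0)
    (mod2 : ∀ a b c a' b' c' x y z, G a b c → G a' b' c' →
      (∀ k, ¬ (a' = k * a ∧ b' = k * b ∧ c' = k * c)) →
      a * x + b * y + c * z = 0 → a' * x + b' * y + c' * z = 0 →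
      ∃ s t, G s t 0 ∧ s * x + t * y = 0)
    (c0 : {a | G 0 1 (-a)}.ncard = n + 1) (c1 : {a | G 1 0 (-a)}.ncard = n + 1)
    (c2 : {a | G 1 (-a) 0}.ncard = n + 1) (h0 : G 0 1 (-1)) (h2 : G 1 (-1) 0) :
    ∀ a b c, G a b c ↔ mono n a b c := by
  obtain ⟨S, hSc, hS⟩ := finset_of_ncard _ n c0 (by simpa using hY)
  obtain ⟨V, hVc, hV⟩ := finset_of_ncard _ n c1 (by simpa using hX)
  obtain ⟨U, hUc, hU⟩ := finset_of_ncard _ n c2 (by simpa using hX)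
  simp only [Set.mem_ofPred_eq] at hS hV hU
  have hS1 : (1 : ℂ) ∈ S := (hS 1).2 ⟨one_ne_zero, h0⟩
  have hU1 : (1 : ℂ) ∈ U := (hU 1).2 ⟨one_ne_zero, h2⟩
  have hS0 : (0 : ℂ) ∉ S := fun h => ((hS 0).1 h).1 rfl
  have hU0 : (0 : ℂ) ∉ U := fun h => ((hU 0).1 h).1 rfl
  have hprod : ∀ a ∈ S, ∀ b ∈ U, b * a ∈ V := by
    intro a ha b hb
    obtain ⟨ha0, haG⟩ := (hS a).1 ha
    obtain ⟨hb0, hbG⟩ := (hU b).1 hb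
    obtain ⟨s, t, hst, he⟩ := mod1 0 1 (-a) 1 (-b) 0 (b * a) a 1 haG hbG
      (by rintro k ⟨h, -, -⟩; simp at h) (by ring) (by ring)
    have hs : s ≠ 0 := by
      rintro rfl
      have : t = 0 := by simpa using he
      subst this; exact G0 hst
    refine (hV _).2 ⟨mul_ne_zero hb0 ha0, ?_⟩
    have := sc s⁻¹ _ _ _ (inv_ne_zero hs) hst
    convert this using 1
    · field_simp
    · simp
    · field_simp; linear_combination -he
  obtain ⟨hVS, hUn⟩ := aux_pow S U V n hSc hVc hS0 hU0 hU1 hprod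
  obtain ⟨hVU, hSn⟩ := aux_pow U S V n hUc hVc hU0 hS0 hS1
    (fun a ha b hb => by rw [mul_comm]; exact hprod b hb a ha)
  have rS := aux_roots S n hn hSc hSn
  have rU := aux_roots U n hn hUc hUn
  have rV := aux_roots V n hn hVc (by rw [hVS]; exact hSn)
  -- lines through the coordinate points
  have gS : ∀ s t, s ≠ 0 → t ≠ 0 → (G 0 s t ↔ (-t / s) ^ n = 1) := by
    intro s t hs ht
    rw [← rS, hS]
    constructor
    · intro h
      refine ⟨div_ne_zero (neg_ne_zero.2 ht) hs, ?_⟩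
      convert sc s⁻¹ _ _ _ (inv_ne_zero hs) h using 1 <;> first | (field_simp; done) | simp
    · rintro ⟨-, h⟩
      convert sc s _ _ _ hs h using 1 <;> first | (field_simp; done) | simp
  have gV : ∀ s t, s ≠ 0 → t ≠ 0 → (G s 0 t ↔ (-t / s) ^ n = 1) := by
    intro s t hs ht
    rw [← rV, hV]
    constructor
    · intro h
      refine ⟨div_ne_zero (neg_ne_zero.2 ht) hs, ?_⟩
      convert sc s⁻¹ _ _ _ (inv_ne_zero hs) h using 1 <;> first | (field_simp; done) | simp
    · rintro ⟨-, h⟩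
      convert sc s _ _ _ hs h using 1 <;> first | (field_simp; done) | simp
  have gU : ∀ s t, s ≠ 0 → t ≠ 0 → (G s t 0 ↔ (-t / s) ^ n = 1) := by
    intro s t hs ht
    rw [← rU, hU]
    constructor
    · intro h
      refine ⟨div_ne_zero (neg_ne_zero.2 ht) hs, ?_⟩
      convert sc s⁻¹ _ _ _ (inv_ne_zero hs) h using 1 <;> first | (field_simp; done) | simp
    · rintro ⟨-, h⟩
      convert sc s _ _ _ hs h using 1 <;> first | (field_simp; done) | simp
  have all : ∀ a b c, a ≠ 0 → b ≠ 0 → c ≠ 0 → ¬ G a b c := by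
    intro a b c ha hb hc hG
    have e0 : (-c / b) ^ n = 1 := by
      obtain ⟨s, t, hst, he⟩ := mod0 a b c 1 0 0 0 c (-b) hG hX
        (by rintro k ⟨h, h', -⟩
            rcases mul_eq_zero.1 h'.symm with h' | h'
            · simp [h'] at h
            · exact hb h') (by ring) (by ring)
      have hs : s ≠ 0 := by
        rintro rfl
        have : t = 0 := by simpa [hb] using he
        subst this; exact G0 hst
      have ht : t ≠ 0 := by
        rintro rfl
        simp [hs, hc] at he
      rw [← (gS s t hs ht).1 hst]
      congr 1
      field_simp
      linear_combination -he
    have e1 : (-c / a) ^ n = 1 := by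
      obtain ⟨s, t, hst, he⟩ := mod1 a b c 0 1 0 c 0 (-a) hG hY
        (by rintro k ⟨h, h', -⟩
            rcases mul_eq_zero.1 h.symm with h | h
            · simp [h] at h'
            · exact ha h) (by ring) (by ring)
      have hs : s ≠ 0 := by
        rintro rfl
        have : t = 0 := by simpa [ha] using he
        subst this; exact G0 hst
      have ht : t ≠ 0 := by
        rintro rfl
        simp [hs, hc] at he
      rw [← (gV s t hs ht).1 hst]
      congr 1
      field_simp
      linear_combination -he
    have e2 : (-b / a) ^ n = 1 := by
      obtain ⟨s, t, hst, he⟩ := mod2 a b c 0 0 1 b (-a) 0 hG hZ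
        (by rintro k ⟨h, -, h'⟩
            rcases mul_eq_zero.1 h.symm with h | h
            · simp [h] at h'
            · exact ha h) (by ring) (by ring)
      have hs : s ≠ 0 := by
        rintro rfl
        have : t = 0 := by simpa [ha] using he
        subst this; exact G0 hst
      have ht : t ≠ 0 := by
        rintro rfl
        simp [hs, hb] at he
      rw [← (gU s t hs ht).1 hst]
      congr 1
      field_simp
      linear_combination -he
    have e3 : (-1 : ℂ) ^ n = 1 := by
      have : (-1 : ℂ) * (-c / a) = (-c / b) * (-b / a) := by field_simp
      have h4 := congrArg (· ^ n) this
      simpa only [mul_pow, e0, e1, e2, mul_one] using h4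
    have hG' : G a (-b) 0 := by
      rw [gU a (-b) ha (neg_ne_zero.2 hb)]
      have : (- -b / a) = (-1) * (-b / a) := by ring
      rw [this, mul_pow, e3, e2, one_mul]
    obtain ⟨s, t, hst, he⟩ := mod0 a b c a (-b) 0 (b * c) (a * c) (-2 * a * b) hG hG'
      (by rintro k ⟨h, -, h'⟩
          rcases mul_eq_zero.1 h'.symm with h' | h'
          · simp [h'] at h; exact ha h
          · exact hc h') (by ring) (by ring)
    have he' : s * c - 2 * t * b = 0 := by
      apply mul_left_cancel₀ ha
      linear_combination he
    have hs : s ≠ 0 := by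
      rintro rfl
      have : t = 0 := by simpa [hb] using he'
      subst this; exact G0 hst
    have ht : t ≠ 0 := by
      rintro rfl
      simp [hs, hc] at he'
    have e5 := (gS s t hs ht).1 hst
    have e6 : (-c / b) = 2 * (-t / s) := by
      field_simp
      linear_combination -he'
    rw [e6, mul_pow, e5, mul_one] at e0
    have : (2 : ℕ) ^ n = 1 := by exact_mod_cast e0
    have h7 : 1 < 2 ^ n := Nat.one_lt_two_pow (by omega)
    omega
  intro a b c
  unfold mono
  by_cases ha : a = 0 <;> by_cases hb : b = 0 <;> by_cases hc : c = 0
  · subst ha hb hc; simpa using G0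
  · subst ha hb; simp [hc]; simpa using sc c _ _ _ hc hZ
  · subst ha hc; simp [hb]; simpa using sc b _ _ _ hb hY
  · subst ha; simpa [hb, hc] using gS b c hb hc
  · subst hb hc; simp [ha]; simpa using sc a _ _ _ ha hX
  · subst hb; simpa [ha, hc] using gV a c ha hc
  · subst hc; simpa [ha, hb] using gU a b ha hb
  · simpa [ha, hb, hc] using all a b c ha hb hc

lemma collinear (G : ℂ → ℂ → ℂ → Prop) (n : ℕ) (hn : 2 ≤ n)
    (sc : ∀ k a b c, k ≠ 0 → G a b c → G (k * a) (k * b) (k * c))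
    (G0 : ¬ G 0 0 0)
    (mod2 : ∀ a b c a' b' c' x y z, G a b c → G a' b' c' →
      (∀ k, ¬ (a' = k * a ∧ b' = k * b ∧ c' = k * c)) →
      a * x + b * y + c * z = 0 → a' * x + b' * y + c' * z = 0 →
      ∃ s t, G s (-s) t ∧ s * x + -s * y + t * z = 0)
    (c0 : {a | G 0 1 (-a)}.ncard = n) (c1 : {a | G 1 0 (-a)}.ncard = n)
    (c2 : {a | G 1 (-1) (-a)}.ncard = n) : False := by
  have f0 := Set.finite_of_ncard_pos (by omega : 0 < {a | G 0 1 (-a)}.ncard)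
  have f1 := Set.finite_of_ncard_pos (by omega : 0 < {a | G 1 0 (-a)}.ncard)
  have f2 := Set.finite_of_ncard_pos (by omega : 0 < {a | G 1 (-1) (-a)}.ncard)
  rw [Set.ncard_eq_toFinset_card _ f0] at c0
  rw [Set.ncard_eq_toFinset_card _ f1] at c1
  rw [Set.ncard_eq_toFinset_card _ f2] at c2
  refine aux_sum _ _ _ n hn c0 c1 c2 ?_
  intro a ha b hb
  simp only [Set.Finite.mem_toFinset, Set.mem_ofPred_eq] at ha hb ⊢
  obtain ⟨s, t, hst, he⟩ := mod2 0 1 (-a) 1 0 (-b) b a 1 ha hb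
      (by rintro k ⟨h, -, -⟩; simp at h) (by ring) (by ring)
  have hs : s ≠ 0 := by
    rintro rfl
    have : t = 0 := by simpa using he
    subst this; simp at hst; exact G0 hst
  have := sc s⁻¹ _ _ _ (inv_ne_zero hs) hst
  convert this using 1
  · field_simp
  · field_simp
  · field_simp; linear_combination -he

/-- The linear form `φ` defines a line of the arrangement `A`. -/
def FormIn (A : Finset ProjLine) (φ : Module.Dual ℂ (Fin 3 → ℂ)) : Prop :=
  ∃ h : φ ≠ 0, Projectivization.mk ℂ φ h ∈ A

/-- The vector `p` represents a modular point of multiplicity `m`. -/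
def ModV (A : Finset ProjLine) (m : ℕ) (p : Fin 3 → ℂ) : Prop :=
  ∃ h : p ≠ 0, IsModular A (Projectivization.mk ℂ p h) ∧ mult A (Projectivization.mk ℂ p h) = m

lemma pointOnLine_mk_s3 (p : Fin 3 → ℂ) (hp : p ≠ 0) (φ : Module.Dual ℂ (Fin 3 → ℂ)) (hφ : φ ≠ 0) :
    PointOnLine (Projectivization.mk ℂ p hp) (Projectivization.mk ℂ φ hφ) ↔ φ p = 0 := by
  unfold PointOnLine
  obtain ⟨a, ha⟩ := Projectivization.exists_smul_eq_mk_rep ℂ p hp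
  obtain ⟨b, hb⟩ := Projectivization.exists_smul_eq_mk_rep ℂ φ hφ
  rw [← ha, ← hb]
  simp [Units.smul_def]

lemma ModV.smul {A : Finset ProjLine} {m : ℕ} {p : Fin 3 → ℂ} (h : ModV A m p) (w : ℂˣ) :
    ModV A m (w • p) := by
  obtain ⟨hp, h1⟩ := h
  have hp' : w • p ≠ 0 := by simpa [smul_eq_zero_iff_eq] using hp
  refine ⟨hp', ?_⟩
  have : Projectivization.mk ℂ (w • p) hp' = Projectivization.mk ℂ p hp := by
    rw [Projectivization.mk_eq_mk_iff]; exact ⟨w, rfl⟩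
  rw [this]; exact h1

lemma FormIn.smul {A : Finset ProjLine} {φ : Module.Dual ℂ (Fin 3 → ℂ)} (h : FormIn A φ)
    {k : ℂ} (hk : k ≠ 0) : FormIn A (k • φ) := by
  obtain ⟨h0, h1⟩ := h
  refine ⟨smul_ne_zero hk h0, ?_⟩
  convert h1 using 1
  rw [Projectivization.mk_eq_mk_iff]
  exact ⟨Units.mk0 k hk, rfl⟩

lemma modular_key {A : Finset ProjLine} {m : ℕ} {p : Fin 3 → ℂ} (h : ModV A m p)
    (φ ψ : Module.Dual ℂ (Fin 3 → ℂ)) (hφ : FormIn A φ) (hψ : FormIn A ψ)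
    (hne : ∀ k : ℂ, ψ ≠ k • φ) (v : Fin 3 → ℂ) (h1 : φ v = 0) (h2 : ψ v = 0) :
    ∃ χ, FormIn A χ ∧ χ p = 0 ∧ χ v = 0 := by
  obtain ⟨hp, ⟨hi, hmod⟩, -⟩ := h
  have hthrough : ∃ χ, FormIn A χ ∧ χ p = 0 := by
    unfold IsIntersectionPoint mult at hi
    obtain ⟨L, hL, hpL⟩ := Set.nonempty_of_ncard_ne_zero (by omega :
      {L : ProjLine | L ∈ A ∧ PointOnLine (Projectivization.mk ℂ p hp) L}.ncard ≠ 0)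
    induction L using Projectivization.ind with
    | h χ hχ => exact ⟨χ, ⟨hχ, hL⟩, (pointOnLine_mk_s3 p hp χ hχ).1 hpL⟩
  obtain ⟨χ, hχ, hχp⟩ := hthrough
  by_cases hv : v = 0
  · exact ⟨χ, hχ, hχp, by simp [hv]⟩
  by_cases hvp : Projectivization.mk ℂ v hv = Projectivization.mk ℂ p hp
  · obtain ⟨a, ha⟩ := (Projectivization.mk_eq_mk_iff ℂ v p hv hp).1 hvp
    exact ⟨χ, hχ, hχp, by rw [← ha]; simp [Units.smul_def, hχp]⟩
  obtain ⟨hφ0, hφA⟩ := hφ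
  obtain ⟨hψ0, hψA⟩ := hψ
  have hiv : IsIntersectionPoint A (Projectivization.mk ℂ v hv) := by
    unfold IsIntersectionPoint mult
    have hne' : Projectivization.mk ℂ φ hφ0 ≠ Projectivization.mk ℂ ψ hψ0 := by
      intro he
      obtain ⟨a, ha⟩ := (Projectivization.mk_eq_mk_iff ℂ _ _ hψ0 hφ0).1 he.symm
      exact hne a (by rw [← ha]; rfl)
    rw [← Set.ncard_pair hne']
    apply Set.ncard_le_ncard
    · rintro L (rfl | rfl)
      · exact ⟨hφA, (pointOnLine_mk_s3 _ _ _ _).2 h1⟩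
      · exact ⟨hψA, (pointOnLine_mk_s3 _ _ _ _).2 h2⟩
    · exact A.finite_toSet.subset (fun L hL => hL.1)
  obtain ⟨L, hLA, hL1, hL2⟩ := hmod _ hiv hvp
  induction L using Projectivization.ind with
  | h χ hχ =>
    exact ⟨χ, ⟨hχ, hLA⟩, (pointOnLine_mk_s3 p hp χ hχ).1 hL1, (pointOnLine_mk_s3 v hv χ hχ).1 hL2⟩

lemma joining_line {A : Finset ProjLine} {m : ℕ} {p q : Fin 3 → ℂ} (h : ModV A m p)
    (h' : ModV A m q) (hne : ∀ k : ℂ, q ≠ k • p) :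
    ∃ χ, FormIn A χ ∧ χ p = 0 ∧ χ q = 0 := by
  obtain ⟨hp, ⟨hi, hmod⟩, -⟩ := h
  obtain ⟨hq, ⟨hi', -⟩, -⟩ := h'
  obtain ⟨L, hLA, hL1, hL2⟩ := hmod _ hi' (by
    intro he
    obtain ⟨a, ha⟩ := (Projectivization.mk_eq_mk_iff ℂ _ _ hq hp).1 he
    exact hne a (by rw [← ha]; rfl))
  induction L using Projectivization.ind with
  | h χ hχ =>
    exact ⟨χ, ⟨hχ, hLA⟩, (pointOnLine_mk_s3 p hp χ hχ).1 hL1, (pointOnLine_mk_s3 q hq χ hχ).1 hL2⟩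

lemma count_lines {A : Finset ProjLine} {m : ℕ} {p : Fin 3 → ℂ} (h : ModV A m p)
    (Y Z : Module.Dual ℂ (Fin 3 → ℂ)) (hY : Y p = 0) (hZ : Z p = 0) (hZA : FormIn A Z)
    (ind : ∀ s t : ℂ, s • Y + t • Z = 0 → s = 0 ∧ t = 0)
    (span : ∀ χ : Module.Dual ℂ (Fin 3 → ℂ), χ p = 0 → ∃ s t : ℂ, χ = s • Y + t • Z) :
    {a : ℂ | FormIn A (Y + (-a) • Z)}.ncard + 1 = m := by
  obtain ⟨hp, -, hm⟩ := h
  obtain ⟨hZ0, hZA'⟩ := hZA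
  have nz : ∀ a : ℂ, Y + (-a) • Z ≠ 0 := by
    intro a ha
    have := ind 1 (-a) (by rw [one_smul]; exact ha)
    exact one_ne_zero this.1
  let f : ℂ → ProjLine := fun a => Projectivization.mk ℂ (Y + (-a) • Z) (nz a)
  have finj : Function.Injective f := by
    intro a b hab
    obtain ⟨k, hk⟩ := (Projectivization.mk_eq_mk_iff' ℂ _ _ (nz a) (nz b)).1 hab
    have := ind (k - 1) (a - k * b) (by
      have h2 : k • (Y + (-b) • Z) - (Y + (-a) • Z) = 0 := sub_eq_zero.2 hk
      rw [← h2]; module)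
    have hk1 : k = 1 := by linear_combination this.1
    rw [hk1] at this
    linear_combination this.2
  have hset : {L : ProjLine | L ∈ A ∧ PointOnLine (Projectivization.mk ℂ p hp) L} =
      insert (Projectivization.mk ℂ Z hZ0) (f '' {a : ℂ | FormIn A (Y + (-a) • Z)}) := by
    ext L
    constructor
    · rintro ⟨hLA, hpL⟩
      induction L using Projectivization.ind with
      | h χ hχ =>
        have hχp := (pointOnLine_mk_s3 p hp χ hχ).1 hpL
        obtain ⟨s, t, hst⟩ := span χ hχp
        by_cases hs : s = 0
        · left
          rw [Projectivization.mk_eq_mk_iff']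
          exact ⟨t, by rw [hst, hs]; simp⟩
        · right
          have he : Y + (-(-t / s)) • Z = s⁻¹ • χ := by
            rw [hst, smul_add, smul_smul, smul_smul, inv_mul_cancel₀ hs, one_smul]
            congr 2
            field_simp
          refine ⟨-t / s, ?_, ?_⟩
          · show FormIn A _
            rw [he]
            exact FormIn.smul ⟨hχ, hLA⟩ (inv_ne_zero hs)
          · show Projectivization.mk _ _ _ = _
            rw [Projectivization.mk_eq_mk_iff']
            exact ⟨s⁻¹, he.symm⟩
    · rintro (rfl | ⟨a, ⟨ha, haA⟩, rfl⟩)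
      · exact ⟨hZA', (pointOnLine_mk_s3 _ _ _ _).2 hZ⟩
      · exact ⟨haA, (pointOnLine_mk_s3 _ _ _ _).2 (by simp [hY, hZ])⟩
  have hfin : (f '' {a : ℂ | FormIn A (Y + (-a) • Z)}).Finite := by
    apply A.finite_toSet.subset
    rintro _ ⟨a, ⟨ha, haA⟩, rfl⟩
    exact haA
  rw [← hm, mult, hset, Set.ncard_insert_of_notMem _ hfin, Set.ncard_image_of_injective _ finj]
  rintro ⟨a, -, ha⟩
  obtain ⟨k, hk⟩ := (Projectivization.mk_eq_mk_iff' ℂ _ _ (nz a) hZ0).1 ha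
  have := ind 1 (-a - k) (by
    have h2 : (Y + (-a) • Z) - k • Z = 0 := sub_eq_zero.2 hk.symm
    rw [← h2]; module)
  exact one_ne_zero this.1

lemma exists_coords (v : Fin 3 → (Fin 3 → ℂ)) (hv : LinearIndependent ℂ v) :
    ∃ T : (Fin 3 → ℂ) ≃ₗ[ℂ] (Fin 3 → ℂ), ∀ i, T (v i) = Pi.single i 1 := by
  let b := basisOfLinearIndependentOfCardEqFinrank hv (by simp)
  refine ⟨b.equivFun, fun i => ?_⟩
  have : b i = v i := by simp [b]
  rw [← this]
  ext j
  simp [Pi.single_apply, eq_comm]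

/-- The form with coefficients `a b c` in the coordinates `T`. -/
def cf (T : (Fin 3 → ℂ) ≃ₗ[ℂ] (Fin 3 → ℂ)) (a b c : ℂ) : Module.Dual ℂ (Fin 3 → ℂ) :=
  (mkForm a b c).comp (T : (Fin 3 → ℂ) →ₗ[ℂ] (Fin 3 → ℂ))

lemma cf_apply (T : (Fin 3 → ℂ) ≃ₗ[ℂ] (Fin 3 → ℂ)) (a b c : ℂ) (v : Fin 3 → ℂ) :
    cf T a b c v = a * T v 0 + b * T v 1 + c * T v 2 := by
  simp [cf, mkForm_apply]

lemma cf_symm (T : (Fin 3 → ℂ) ≃ₗ[ℂ] (Fin 3 → ℂ)) (a b c x y z : ℂ) :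
    cf T a b c (T.symm ![x, y, z]) = a * x + b * y + c * z := by
  simp [cf_apply]

lemma cf_ext (T : (Fin 3 → ℂ) ≃ₗ[ℂ] (Fin 3 → ℂ)) (φ : Module.Dual ℂ (Fin 3 → ℂ)) :
    φ = cf T (φ (T.symm ![1, 0, 0])) (φ (T.symm ![0, 1, 0])) (φ (T.symm ![0, 0, 1])) := by
  refine LinearMap.ext fun v => ?_
  obtain ⟨w, rfl⟩ := T.symm.surjective v
  rw [cf_apply]
  have : w = w 0 • ![1, 0, 0] + w 1 • ![0, 1, 0] + w 2 • ![0, 0, 1] := by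
    ext i; fin_cases i <;> simp
  conv_lhs => rw [this]
  simp only [map_add, map_smul, smul_eq_mul, LinearEquiv.apply_symm_apply]
  ring

lemma cf_inj (T : (Fin 3 → ℂ) ≃ₗ[ℂ] (Fin 3 → ℂ)) {a b c a' b' c' : ℂ}
    (h : cf T a b c = cf T a' b' c') : a = a' ∧ b = b' ∧ c = c' := by
  have h1 := congrArg (fun φ => φ (T.symm ![1, 0, 0])) h
  have h2 := congrArg (fun φ => φ (T.symm ![0, 1, 0])) h
  have h3 := congrArg (fun φ => φ (T.symm ![0, 0, 1])) h
  simp only [cf_symm] at h1 h2 h3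
  refine ⟨?_, ?_, ?_⟩ <;> simp_all

lemma cf_smul (T : (Fin 3 → ℂ) ≃ₗ[ℂ] (Fin 3 → ℂ)) (k a b c : ℂ) :
    k • cf T a b c = cf T (k * a) (k * b) (k * c) := by
  refine LinearMap.ext fun v => ?_
  simp [cf_apply]; ring

lemma cf_add (T : (Fin 3 → ℂ) ≃ₗ[ℂ] (Fin 3 → ℂ)) (a b c a' b' c' : ℂ) :
    cf T a b c + cf T a' b' c' = cf T (a + a') (b + b') (c + c') := by
  refine LinearMap.ext fun v => ?_
  simp [cf_apply]; ring

lemma cf_zero (T : (Fin 3 → ℂ) ≃ₗ[ℂ] (Fin 3 → ℂ)) : cf T 0 0 0 = 0 := by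
  refine LinearMap.ext fun v => ?_
  simp [cf_apply]

lemma G_scale (A : Finset ProjLine) (T : (Fin 3 → ℂ) ≃ₗ[ℂ] (Fin 3 → ℂ)) :
    ∀ k a b c, k ≠ 0 → FormIn A (cf T a b c) → FormIn A (cf T (k * a) (k * b) (k * c)) := by
  intro k a b c hk h
  rw [← cf_smul]; exact h.smul hk

lemma G_zero (A : Finset ProjLine) (T : (Fin 3 → ℂ) ≃ₗ[ℂ] (Fin 3 → ℂ)) :
    ¬ FormIn A (cf T 0 0 0) := by
  rintro ⟨h, -⟩; exact h (cf_zero T)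

lemma G_mod {A : Finset ProjLine} {m : ℕ} (T : (Fin 3 → ℂ) ≃ₗ[ℂ] (Fin 3 → ℂ)) (p0 p1 p2 : ℂ)
    (hp : ModV A m (T.symm ![p0, p1, p2])) :
    ∀ a b c a' b' c' x y z, FormIn A (cf T a b c) → FormIn A (cf T a' b' c') →
      (∀ k, ¬ (a' = k * a ∧ b' = k * b ∧ c' = k * c)) →
      a * x + b * y + c * z = 0 → a' * x + b' * y + c' * z = 0 →
      ∃ r s t, FormIn A (cf T r s t) ∧ r * p0 + s * p1 + t * p2 = 0 ∧
        r * x + s * y + t * z = 0 := by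
  intro a b c a' b' c' x y z h h' hk h1 h2
  obtain ⟨χ, hχ, e1, e2⟩ := modular_key hp _ _ h h' (by
    intro k he
    rw [cf_smul] at he
    exact hk k (cf_inj T he)) (T.symm ![x, y, z]) (by rw [cf_symm]; exact h1)
      (by rw [cf_symm]; exact h2)
  rw [cf_ext T χ] at hχ e1 e2
  rw [cf_symm] at e1 e2
  exact ⟨_, _, _, hχ, e1, e2⟩

lemma G_join {A : Finset ProjLine} {m : ℕ} (T : (Fin 3 → ℂ) ≃ₗ[ℂ] (Fin 3 → ℂ))
    (p0 p1 p2 q0 q1 q2 : ℂ)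
    (hp : ModV A m (T.symm ![p0, p1, p2])) (hq : ModV A m (T.symm ![q0, q1, q2]))
    (hne : ∀ k, ¬ (q0 = k * p0 ∧ q1 = k * p1 ∧ q2 = k * p2)) :
    ∃ r s t, FormIn A (cf T r s t) ∧ r * p0 + s * p1 + t * p2 = 0 ∧
        r * q0 + s * q1 + t * q2 = 0 := by
  obtain ⟨χ, hχ, e1, e2⟩ := joining_line hp hq (by
    intro k he
    rw [← map_smul] at he
    have := T.symm.injective he
    have h0 := congrFun this 0
    have h1 := congrFun this 1
    have h2 := congrFun this 2
    simp at h0 h1 h2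
    exact hne k ⟨h0, h1, h2⟩)
  rw [cf_ext T χ] at hχ e1 e2
  rw [cf_symm] at e1 e2
  exact ⟨_, _, _, hχ, e1, e2⟩

lemma cf_refl (a b c : ℂ) : cf (LinearEquiv.refl ℂ (Fin 3 → ℂ)) a b c = mkForm a b c := rfl

lemma mk_eq_mkLine_iff {a b c a' b' c' : ℂ} (h : mkForm a b c ≠ 0)
    (h' : a' ≠ 0 ∨ b' ≠ 0 ∨ c' ≠ 0) :
    Projectivization.mk ℂ (mkForm a b c) h = mkLine a' b' c' h' ↔
      ∃ k : ℂ, a = k * a' ∧ b = k * b' ∧ c = k * c' := by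
  unfold mkLine
  rw [Projectivization.mk_eq_mk_iff']
  constructor
  · rintro ⟨k, hk⟩
    refine ⟨k, ?_⟩
    rw [← cf_refl, ← cf_refl, cf_smul] at hk
    exact cf_inj _ hk.symm
  · rintro ⟨k, h1, h2, h3⟩
    refine ⟨k, ?_⟩
    rw [← cf_refl, ← cf_refl, cf_smul, h1, h2, h3]

lemma mem_monomialArr (m : ℕ) (hm : 3 ≤ m) {a b c : ℂ} (h : mkForm a b c ≠ 0) :
    Projectivization.mk ℂ (mkForm a b c) h ∈ monomialArr m ↔ mono (m - 2) a b c := by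
  have hn : 0 < m - 2 := by omega
  have h0 : ¬ (a = 0 ∧ b = 0 ∧ c = 0) := by
    rintro ⟨rfl, rfl, rfl⟩
    exact h (by rw [← cf_refl, cf_zero])
  simp only [monomialArr, Finset.mem_union, Finset.mem_insert, Finset.mem_singleton,
    Finset.mem_image, Multiset.mem_toFinset, Polynomial.mem_nthRoots hn, mk_eq_mkLine_iff,
    eq_comm (b := Projectivization.mk ℂ (mkForm a b c) h)]
  unfold mono
  constructor
  · rintro ((((⟨k, h1, h2, h3⟩ | ⟨k, h1, h2, h3⟩ | ⟨k, h1, h2, h3⟩) | ⟨ζ, hζ, k, h1, h2, h3⟩) |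
      ⟨ζ, hζ, k, h1, h2, h3⟩) | ⟨ζ, hζ, k, h1, h2, h3⟩)
    · simp only [mul_zero] at h2 h3
      left; exact ⟨fun ha => h0 ⟨ha, h2, h3⟩, h2, h3⟩
    · simp only [mul_zero] at h1 h3
      right; left; exact ⟨h1, fun ha => h0 ⟨h1, ha, h3⟩, h3⟩
    · simp only [mul_zero] at h1 h2
      right; right; left; exact ⟨h1, h2, fun ha => h0 ⟨h1, h2, ha⟩⟩
    · have hζ0 : ζ ≠ 0 := by rintro rfl; simp [hn.ne'] at hζ
      have hk : k ≠ 0 := by rintro rfl; apply h0; simp_all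
      right; right; right; left
      subst h1 h2 h3
      refine ⟨by simpa using hk, by simp [hk, hζ0], by simp, ?_⟩
      convert hζ using 2; field_simp
    · have hζ0 : ζ ≠ 0 := by rintro rfl; simp [hn.ne'] at hζ
      have hk : k ≠ 0 := by rintro rfl; apply h0; simp_all
      right; right; right; right; left
      subst h1 h2 h3
      refine ⟨by simp, by simpa using hk, by simp [hk, hζ0], ?_⟩
      convert hζ using 2; field_simp
    · have hζ0 : ζ ≠ 0 := by rintro rfl; simp [hn.ne'] at hζ
      have hk : k ≠ 0 := by rintro rfl; apply h0; simp_all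
      right; right; right; right; right
      subst h1 h2 h3
      refine ⟨by simpa using hk, by simp, by simp [hk, hζ0], ?_⟩
      convert hζ using 2; field_simp
  · rintro (⟨h1, rfl, rfl⟩ | ⟨rfl, h2, rfl⟩ | ⟨rfl, rfl, h3⟩ | ⟨h1, h2, rfl, he⟩ |
      ⟨rfl, h2, h3, he⟩ | ⟨h1, rfl, h3, he⟩)
    · left; left; left; left; exact ⟨a, by simp⟩
    · left; left; left; right; left; exact ⟨b, by simp⟩
    · left; left; left; right; right; exact ⟨c, by simp⟩
    · left; left; right; exact ⟨_, he, a, by simp, by field_simp, by simp⟩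
    · left; right; exact ⟨_, he, b, by simp, by simp, by field_simp⟩
    · right; exact ⟨_, he, a, by simp, by simp, by field_simp⟩

lemma projEquiv_of_coords (A : Finset ProjLine) (m : ℕ) (hm : 3 ≤ m)
    (T : (Fin 3 → ℂ) ≃ₗ[ℂ] (Fin 3 → ℂ))
    (h : ∀ a b c, FormIn A (cf T a b c) ↔ mono (m - 2) a b c) :
    ProjEquiv A (monomialArr m) := by
  have hmap : ∀ a b c (h1 : cf T a b c ≠ 0) (h2 : mkForm a b c ≠ 0),
      lineMap T (Projectivization.mk ℂ (cf T a b c) h1) =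
        Projectivization.mk ℂ (mkForm a b c) h2 := by
    intro a b c h1 h2
    unfold lineMap
    rw [Projectivization.map_mk]
    congr 1
    refine LinearMap.ext fun v => ?_
    simp [cf]
  have hz : ∀ a b c, cf T a b c ≠ 0 ↔ mkForm a b c ≠ 0 := by
    intro a b c
    rw [not_iff_not, ← cf_refl]
    constructor
    · intro hh
      obtain ⟨rfl, rfl, rfl⟩ := cf_inj T (hh.trans (cf_zero T).symm)
      exact cf_zero _
    · intro hh
      obtain ⟨rfl, rfl, rfl⟩ := cf_inj _ (hh.trans (cf_zero _).symm)
      exact cf_zero _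
  refine ⟨T, ?_⟩
  ext M
  constructor
  · rintro ⟨L, hL, rfl⟩
    induction L using Projectivization.ind with
    | h φ hφ =>
      obtain ⟨a, b, c, rfl⟩ : ∃ a b c, φ = cf T a b c := ⟨_, _, _, cf_ext T φ⟩
      rw [hmap a b c hφ ((hz a b c).1 hφ)]
      exact (mem_monomialArr m hm _).2 ((h a b c).1 ⟨hφ, hL⟩)
  · intro hM
    induction M using Projectivization.ind with
    | h φ hφ =>
      obtain ⟨a, b, c, rfl⟩ : ∃ a b c, φ = mkForm a b c :=
        ⟨_, _, _, cf_ext (LinearEquiv.refl ℂ (Fin 3 → ℂ)) φ⟩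
      obtain ⟨h1, h2⟩ := (h a b c).2 ((mem_monomialArr m hm _).1 hM)
      exact ⟨_, h2, hmap a b c h1 hφ⟩

/-- A coordinate system adapted to three independent modular points. -/
lemma coords_data (v : Fin 3 → (Fin 3 → ℂ))
    (T : (Fin 3 → ℂ) ≃ₗ[ℂ] (Fin 3 → ℂ)) (hT : ∀ i, T (v i) = Pi.single i 1) :
    v 0 = T.symm ![1, 0, 0] ∧ v 1 = T.symm ![0, 1, 0] ∧ v 2 = T.symm ![0, 0, 1] := by
  refine ⟨?_, ?_, ?_⟩ <;> rw [LinearEquiv.eq_symm_apply, hT] <;> ext i <;> fin_cases i <;> simp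

lemma lines_data (A : Finset ProjLine) (m : ℕ)
    (T : (Fin 3 → ℂ) ≃ₗ[ℂ] (Fin 3 → ℂ)) (h0 : ModV A m (T.symm ![1, 0, 0]))
    (h1 : ModV A m (T.symm ![0, 1, 0])) (h2 : ModV A m (T.symm ![0, 0, 1])) :
    FormIn A (cf T 1 0 0) ∧ FormIn A (cf T 0 1 0) ∧ FormIn A (cf T 0 0 1) ∧
    {a | FormIn A (cf T 0 1 (-a))}.ncard + 1 = m ∧ {a | FormIn A (cf T 1 0 (-a))}.ncard + 1 = m ∧
    {a | FormIn A (cf T 1 (-a) 0)}.ncard + 1 = m := by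
  have hX : FormIn A (cf T 1 0 0) := by
    obtain ⟨r, s, t, hG, e1, e2⟩ := G_join T _ _ _ _ _ _ h1 h2 (by simp)
    have hs : s = 0 := by simpa using e1
    have ht : t = 0 := by simpa using e2
    subst hs ht
    have hr : r ≠ 0 := by rintro rfl; exact G_zero A T hG
    simpa [hr] using G_scale A T r⁻¹ _ _ _ (inv_ne_zero hr) hG
  have hY : FormIn A (cf T 0 1 0) := by
    obtain ⟨r, s, t, hG, e1, e2⟩ := G_join T _ _ _ _ _ _ h0 h2 (by simp)
    have hs : r = 0 := by simpa using e1
    have ht : t = 0 := by simpa using e2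
    subst hs ht
    have hr : s ≠ 0 := by rintro rfl; exact G_zero A T hG
    simpa [hr] using G_scale A T s⁻¹ _ _ _ (inv_ne_zero hr) hG
  have hZ : FormIn A (cf T 0 0 1) := by
    obtain ⟨r, s, t, hG, e1, e2⟩ := G_join T _ _ _ _ _ _ h0 h1 (by simp)
    have hs : r = 0 := by simpa using e1
    have ht : s = 0 := by simpa using e2
    subst hs ht
    have hr : t ≠ 0 := by rintro rfl; exact G_zero A T hG
    simpa [hr] using G_scale A T t⁻¹ _ _ _ (inv_ne_zero hr) hG
  refine ⟨hX, hY, hZ, ?_, ?_, ?_⟩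
  · have := count_lines h0 (cf T 0 1 0) (cf T 0 0 1) (by simp [cf_symm]) (by simp [cf_symm]) hZ
      (by
        intro s t hst
        rw [cf_smul, cf_smul, cf_add, ← cf_zero T] at hst
        simpa using cf_inj T hst)
      (by
        intro χ hχ
        refine ⟨χ (T.symm ![0, 1, 0]), χ (T.symm ![0, 0, 1]), ?_⟩
        rw [cf_smul, cf_smul, cf_add]
        conv_lhs => rw [cf_ext T χ, hχ]
        simp)
    simpa only [cf_smul, cf_add, mul_zero, mul_one, add_zero, zero_add] using this
  · have := count_lines h1 (cf T 1 0 0) (cf T 0 0 1) (by simp [cf_symm]) (by simp [cf_symm]) hZ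
      (by
        intro s t hst
        rw [cf_smul, cf_smul, cf_add, ← cf_zero T] at hst
        simpa using cf_inj T hst)
      (by
        intro χ hχ
        refine ⟨χ (T.symm ![1, 0, 0]), χ (T.symm ![0, 0, 1]), ?_⟩
        rw [cf_smul, cf_smul, cf_add]
        conv_lhs => rw [cf_ext T χ, hχ]
        simp)
    simpa only [cf_smul, cf_add, mul_zero, mul_one, add_zero, zero_add] using this
  · have := count_lines h2 (cf T 1 0 0) (cf T 0 1 0) (by simp [cf_symm]) (by simp [cf_symm]) hY
      (by
        intro s t hst
        rw [cf_smul, cf_smul, cf_add, ← cf_zero T] at hst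
        simpa using cf_inj T hst)
      (by
        intro χ hχ
        refine ⟨χ (T.symm ![1, 0, 0]), χ (T.symm ![0, 1, 0]), ?_⟩
        rw [cf_smul, cf_smul, cf_add]
        conv_lhs => rw [cf_ext T χ, hχ]
        simp)
    simpa only [cf_smul, cf_add, mul_zero, mul_one, add_zero, zero_add] using this

lemma case_noncollinear (A : Finset ProjLine) (m : ℕ) (hm : 3 ≤ m) (v : Fin 3 → (Fin 3 → ℂ))
    (hv : LinearIndependent ℂ v) (h : ∀ i, ModV A m (v i)) : ProjEquiv A (monomialArr m) := by
  obtain ⟨T, hT⟩ := exists_coords v hv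
  obtain ⟨e0, e1, e2⟩ := coords_data v T hT
  obtain ⟨hX, hY, hZ, c0, c1, c2⟩ := lines_data A m T (e0 ▸ h 0) (e1 ▸ h 1) (e2 ▸ h 2)
  obtain ⟨S, hSc, hS⟩ := finset_of_ncard _ (m - 2) (by omega :
    {a | FormIn A (cf T 0 1 (-a))}.ncard = m - 2 + 1) (by simpa using hY)
  obtain ⟨U, hUc, hU⟩ := finset_of_ncard _ (m - 2) (by omega :
    {a | FormIn A (cf T 1 (-a) 0)}.ncard = m - 2 + 1) (by simpa using hX)
  obtain ⟨α, hα⟩ := Finset.card_pos.1 (by omega : 0 < S.card)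
  obtain ⟨γ, hγ⟩ := Finset.card_pos.1 (by omega : 0 < U.card)
  obtain ⟨hα0, hα⟩ := (hS α).1 hα
  obtain ⟨hγ0, hγ⟩ := (hU γ).1 hγ
  have hα : FormIn A (cf T 0 1 (-α)) := hα
  have hγ : FormIn A (cf T 1 (-γ) 0) := hγ
  let w : Fin 3 → ℂˣ := ![Units.mk0 γ hγ0, 1, (Units.mk0 α hα0)⁻¹]
  obtain ⟨T', hT'⟩ := exists_coords (w • v) (hv.units_smul w)
  have h' : ∀ i, ModV A m ((w • v) i) := fun i => (h i).smul (w i)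
  obtain ⟨e0', e1', e2'⟩ := coords_data (w • v) T' hT'
  obtain ⟨hX', hY', hZ', c0', c1', c2'⟩ :=
    lines_data A m T' (e0' ▸ h' 0) (e1' ▸ h' 1) (e2' ▸ h' 2)
  have f0 : T'.symm ![1, 0, 0] = γ • T.symm ![1, 0, 0] := by
    rw [← e0', ← e0]; simp [w, Units.smul_def]
  have f1 : T'.symm ![0, 1, 0] = T.symm ![0, 1, 0] := by
    rw [← e1', ← e1]; simp [w]
  have f2 : T'.symm ![0, 0, 1] = α⁻¹ • T.symm ![0, 0, 1] := by
    rw [← e2', ← e2]; simp [w, Units.smul_def]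
  have conv : ∀ a b c, cf T a b c = cf T' (a * γ) b (c * α⁻¹) := by
    intro a b c
    rw [cf_ext T' (cf T a b c), f0, f1, f2]
    simp only [map_smul, cf_symm, smul_eq_mul]
    congr 1 <;> ring
  refine projEquiv_of_coords A m hm T' ?_
  refine noncollinear (fun a b c => FormIn A (cf T' a b c)) (m - 2) (by omega) (G_scale A T')
    (G_zero A T') hX' hY' hZ' ?_ ?_ ?_ (by omega) (by omega) (by omega) ?_ ?_
  · intro a b c a' b' c' x y z g1 g2 g3 g4 g5
    obtain ⟨r, s, t, hG, k1, k2⟩ := G_mod T' _ _ _ (e0' ▸ h' 0) a b c a' b' c' x y z g1 g2 g3 g4 g5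
    have : r = 0 := by simpa using k1
    subst this
    exact ⟨s, t, hG, by simpa using k2⟩
  · intro a b c a' b' c' x y z g1 g2 g3 g4 g5
    obtain ⟨r, s, t, hG, k1, k2⟩ := G_mod T' _ _ _ (e1' ▸ h' 1) a b c a' b' c' x y z g1 g2 g3 g4 g5
    have : s = 0 := by simpa using k1
    subst this
    exact ⟨r, t, hG, by simpa using k2⟩
  · intro a b c a' b' c' x y z g1 g2 g3 g4 g5
    obtain ⟨r, s, t, hG, k1, k2⟩ := G_mod T' _ _ _ (e2' ▸ h' 2) a b c a' b' c' x y z g1 g2 g3 g4 g5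
    have : t = 0 := by simpa using k1
    subst this
    exact ⟨r, s, hG, by simpa using k2⟩
  · rw [conv] at hα
    simpa [hα0] using hα
  · rw [conv] at hγ
    simpa [hγ0] using G_scale A T' γ⁻¹ _ _ _ (inv_ne_zero hγ0) hγ

lemma case_collinear (A : Finset ProjLine) (m : ℕ) (hm : 3 ≤ m) (v : Fin 3 → (Fin 3 → ℂ))
    (hv : LinearIndependent ℂ v) (h0 : ModV A m (v 0)) (h1 : ModV A m (v 1))
    (h2 : ModV A m (v 0 + v 1)) : False := by
  obtain ⟨T, hT⟩ := exists_coords v hv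
  obtain ⟨e0, e1, e2⟩ := coords_data v T hT
  have e3 : v 0 + v 1 = T.symm ![1, 1, 0] := by
    rw [e0, e1, ← map_add]; congr 1; ext i; fin_cases i <;> simp
  rw [e3] at h2
  rw [e0] at h0
  rw [e1] at h1
  have hZ : FormIn A (cf T 0 0 1) := by
    obtain ⟨r, s, t, hG, e1, e2⟩ := G_join T _ _ _ _ _ _ h0 h1 (by simp)
    have hs : r = 0 := by simpa using e1
    have ht : s = 0 := by simpa using e2
    subst hs ht
    have hr : t ≠ 0 := by rintro rfl; exact G_zero A T hG
    simpa [hr] using G_scale A T t⁻¹ _ _ _ (inv_ne_zero hr) hG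
  have c0 := count_lines h0 (cf T 0 1 0) (cf T 0 0 1) (by simp [cf_symm]) (by simp [cf_symm]) hZ
      (by
        intro s t hst
        rw [cf_smul, cf_smul, cf_add, ← cf_zero T] at hst
        simpa using cf_inj T hst)
      (by
        intro χ hχ
        refine ⟨χ (T.symm ![0, 1, 0]), χ (T.symm ![0, 0, 1]), ?_⟩
        rw [cf_smul, cf_smul, cf_add]
        conv_lhs => rw [cf_ext T χ, hχ]
        simp)
  have c1 := count_lines h1 (cf T 1 0 0) (cf T 0 0 1) (by simp [cf_symm]) (by simp [cf_symm]) hZ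
      (by
        intro s t hst
        rw [cf_smul, cf_smul, cf_add, ← cf_zero T] at hst
        simpa using cf_inj T hst)
      (by
        intro χ hχ
        refine ⟨χ (T.symm ![1, 0, 0]), χ (T.symm ![0, 0, 1]), ?_⟩
        rw [cf_smul, cf_smul, cf_add]
        conv_lhs => rw [cf_ext T χ, hχ]
        simp)
  have c2 := count_lines h2 (cf T 1 (-1) 0) (cf T 0 0 1) (by simp [cf_symm]) (by simp [cf_symm]) hZ
      (by
        intro s t hst
        rw [cf_smul, cf_smul, cf_add, ← cf_zero T] at hst
        have := cf_inj T hst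
        simp at this
        exact ⟨this.1, this.2⟩)
      (by
        intro χ hχ
        refine ⟨χ (T.symm ![1, 0, 0]), χ (T.symm ![0, 0, 1]), ?_⟩
        rw [cf_smul, cf_smul, cf_add]
        have hh : χ (T.symm ![0, 1, 0]) = - χ (T.symm ![1, 0, 0]) := by
          rw [← e3, e0, e1, map_add] at hχ
          linear_combination hχ
        conv_lhs => rw [cf_ext T χ, hh]
        simp)
  simp only [cf_smul, cf_add, mul_zero, mul_one, add_zero, zero_add] at c0 c1 c2
  refine collinear (fun a b c => FormIn A (cf T a b c)) (m - 1) (by omega) (G_scale A T)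
    (G_zero A T) ?_ (by omega) (by omega) (by omega)
  intro a b c a' b' c' x y z g1 g2 g3 g4 g5
  obtain ⟨r, s, t, hG, k1, k2⟩ := G_mod T _ _ _ h2 a b c a' b' c' x y z g1 g2 g3 g4 g5
  have : s = -r := by
    simp at k1
    linear_combination k1
  subst this
  exact ⟨r, t, hG, k2⟩

/-- An `m`-homogeneous supersolvable line arrangement with `m ≥ 3`
having at least `3` modular points is projectively equivalent to the full monomial
arrangement `A(m-2,1,3)`. -/
theorem projEquiv_monomial_of_three_modular (A : Finset ProjLine) (m : ℕ) (hm : 3 ≤ m)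
    (h : IsHomogSS A m)
    (h3 : 3 ≤ {p : ProjPoint | IsModular A p}.ncard) :
    ProjEquiv A (monomialArr m) := by
  have hfin : {p : ProjPoint | IsModular A p}.Finite := Set.finite_of_ncard_pos (by omega)
  obtain ⟨x, y, z, hx, hy, hz, hxy, hxz, hyz⟩ := (Set.two_lt_ncard_iff hfin).1 h3
  have mv : ∀ p : ProjPoint, IsModular A p → ModV A m p.rep := by
    intro p hp
    refine ⟨p.rep_nonzero, ?_⟩
    rw [Projectivization.mk_rep]
    exact ⟨hp, h.2 p hp⟩
  have mx := mv x hx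
  have my := mv y hy
  have mz := mv z hz
  have prop : ∀ p q : ProjPoint, p ≠ q → ∀ k : ℂ, p.rep ≠ k • q.rep := by
    intro p q hpq k hk
    apply hpq
    rw [← p.mk_rep, ← q.mk_rep, Projectivization.mk_eq_mk_iff']
    exact ⟨k, hk.symm⟩
  have lixy : LinearIndependent ℂ ![x.rep, y.rep] := by
    rw [LinearIndependent.pair_iff' x.rep_nonzero]
    intro k hk
    exact prop y x hxy.symm k hk.symm
  by_cases hli : z.rep ∈ Submodule.span ℂ (Set.range ![x.rep, y.rep])
  · exfalso
    simp only [Matrix.range_cons, Matrix.range_empty, Set.union_empty,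
      Set.singleton_union] at hli
    obtain ⟨s, t, hst⟩ := Submodule.mem_span_pair.1 hli
    have hs : s ≠ 0 := by
      rintro rfl
      exact prop z y hyz.symm t (by rw [← hst]; simp)
    have ht : t ≠ 0 := by
      rintro rfl
      exact prop z x hxz.symm s (by rw [← hst]; simp)
    obtain ⟨w, hw⟩ : ∃ w, w ∉ Submodule.span ℂ (Set.range ![x.rep, y.rep]) := by
      by_contra! hall
      have htop : Submodule.span ℂ (Set.range ![x.rep, y.rep]) = ⊤ := by
        rw [eq_top_iff]; intro u _; exact hall u
      have h1 := finrank_span_eq_card lixy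
      rw [htop] at h1
      simp at h1
    have li3 : LinearIndependent ℂ (Fin.snoc ![x.rep, y.rep] w : Fin 3 → (Fin 3 → ℂ)) :=
      lixy.finSnoc hw
    have li4 := li3.units_smul ![Units.mk0 s hs, Units.mk0 t ht, 1]
    refine case_collinear A m hm _ li4 (mx.smul (Units.mk0 s hs)) (my.smul (Units.mk0 t ht)) ?_
    rw [← hst] at mz
    exact mz
  · have li3 : LinearIndependent ℂ (Fin.snoc ![x.rep, y.rep] z.rep : Fin 3 → (Fin 3 → ℂ)) :=
      lixy.finSnoc hli
    refine case_noncollinear A m hm _ li3 ?_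
    intro i
    fin_cases i
    · exact mx
    · exact my
    · exact mz

end
end
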